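/- arXiv:2203.14399 — 8 statements merged into one kernel-verified Lean document; each statement's English description precedes it below -/
import Mathlib

section
/- Scaling property of the ϑ-Fourier transform: let d ≥ 1 be an integer, q ≥ 1, η, λ real, α = η + dλ(1-q), and let p be a probability density on ℝ^d. For r > 0 define the rescaled density p_r(x) = r^{-d} p(x/r) (the density of rX when X has density p). Then for every k ∈ ℝ^d, F_{p_r}(k) = F_p(r^α k). -/
open MeasureTheory Real
open scoped RealInnerProductSpace

/-- The complex `q`-exponential: `exp_q(z) = (1+(1-q)z)^{1/(1-q)}` (principal branch),
and the usual exponential for `q = 1`. -/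
noncomputable def qExpC (q : ℝ) (z : ℂ) : ℂ :=
  if q = 1 then Complex.exp z else (1 + (1 - q) * z) ^ ((1 / (1 - q) : ℂ))

/-- The ϑ-Fourier transform of a density `p` on `ℝ^d`:
`F_p(k) = ∫_{{p>0}} p(x) exp_q(i (k·x) p(x)^{(1-α)/d}) dx`. -/
noncomputable def thetaFT (q α : ℝ) (d : ℕ) (p : EuclideanSpace ℝ (Fin d) → ℝ)
    (k : EuclideanSpace ℝ (Fin d)) : ℂ :=
  ∫ x in {x | 0 < p x}, (p x : ℂ) *
    qExpC q (Complex.I * ((⟪k, x⟫ : ℝ) : ℂ) * ((p x ^ ((1 - α) / (d : ℝ)) : ℝ) : ℂ))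

/-- How `r * a ^ ((1 - α) / d)` changes when `a` is rescaled to `r ^ (-d) * a`. -/
theorem mul_rescaled_rpow {r a : ℝ} (hr : 0 < r) (ha : 0 ≤ a) {d : ℕ} (hd : 1 ≤ d) (α : ℝ) :
    r * (r ^ (-(d : ℝ)) * a) ^ ((1 - α) / (d : ℝ)) = r ^ α * a ^ ((1 - α) / (d : ℝ)) := by
  have hd0 : (d : ℝ) ≠ 0 := by positivity
  have hexp : -(d : ℝ) * ((1 - α) / d) = α - 1 := by field_simp; ring
  rw [mul_rpow (by positivity) ha, ← rpow_mul hr.le, hexp, rpow_sub_one hr.ne']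
  field_simp

/-- scaling property of the ϑ-Fourier transform:
for a probability density `p` on `ℝ^d`, `r > 0` and `α = η + dλ(1-q)`,
the transform of the density `x ↦ r^{-d} p(x/r)` of `rX` at `k` equals `F_p(r^α k)`. -/
theorem stmt2 (d : ℕ) (hd : 1 ≤ d) (q η lam : ℝ) (hq : 1 ≤ q)
    (p : EuclideanSpace ℝ (Fin d) → ℝ) (hp0 : ∀ x, 0 ≤ p x)
    (hp1 : (∫ x, p x) = 1) (r : ℝ) (hr : 0 < r) (k : EuclideanSpace ℝ (Fin d)) :
    thetaFT q (η + d * lam * (1 - q)) d (fun x => r ^ (-(d : ℝ)) * p (r⁻¹ • x)) k =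
      thetaFT q (η + d * lam * (1 - q)) d p ((r ^ (η + d * lam * (1 - q))) • k) := by
  have hrd : 0 < r ^ (-(d : ℝ)) := by positivity
  generalize η + d * lam * (1 - q) = α
  unfold thetaFT
  open scoped Pointwise in
  have hset : {x | 0 < r ^ (-(d : ℝ)) * p (r⁻¹ • x)} = r • {x | 0 < p x} := by
    ext x
    simp only [Set.mem_smul_set_iff_inv_smul_mem₀ hr.ne', Set.mem_ofPred_eq,
      mul_pos_iff_of_pos_left hrd]
  have hcancel : ((r ^ d : ℝ) : ℂ) * ((r ^ (-(d : ℝ)) : ℝ) : ℂ) = 1 := by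
    rw [← Complex.ofReal_mul, rpow_neg hr.le, rpow_natCast, mul_inv_cancel₀ (by positivity),
      Complex.ofReal_one]
  have hsub := Measure.setIntegral_comp_smul volume (fun x : EuclideanSpace ℝ (Fin d) =>
    ((r ^ (-(d : ℝ)) * p (r⁻¹ • x) : ℝ) : ℂ) *
      qExpC q (Complex.I * ((⟪k, x⟫ : ℝ) : ℂ) *
        (((r ^ (-(d : ℝ)) * p (r⁻¹ • x)) ^ ((1 - α) / (d : ℝ)) : ℝ) : ℂ)))
    {x | 0 < p x} hr.ne'
  rw [finrank_euclideanSpace_fin, abs_of_pos (by positivity),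
    eq_inv_smul_iff₀ (by positivity)] at hsub
  rw [hset, ← hsub, Complex.real_smul, ← integral_const_mul]
  congr 1
  funext x
  rw [inv_smul_smul₀ hr.ne', inner_smul_left, inner_smul_right, Complex.ofReal_mul, ← mul_assoc,
    ← mul_assoc, hcancel, one_mul]
  congr 2
  rw [mul_assoc, mul_assoc, ← Complex.ofReal_mul, ← Complex.ofReal_mul]
  congr 2
  have h := mul_rescaled_rpow hr (hp0 x) hd α
  simp only [conj_trivial]
  linear_combination ⟪k, x⟫ * h
end

section
/- Multivariate q-Fourier transform of a q-Gaussian (multivariate version of Umarov–Tsallis–Steinberg's Lemma): let d ≥ 1 be an integer, 1 < q < (d+4)/(d+2), and let Σ be a symmetric positive-definite d×d real matrix. Then for every k ∈ ℝ^d, ∫_{ℝ^d} G_q(x;0,Σ) · exp_q(i (k·x) G_q(x;0,Σ)^{q-1}) dx = exp_{q̃}( - (2_{qd}[2+d(1-q)] / (8 (2_{qd} π_{qd})^{d(q-1)})) · (kᵀΣk) / (det Σ)^{q-1} ), where q̃ = [2+(d-2)(1-q)] / [2+d(1-q)]. In particular, the q-Fourier transform of a d-dimensional q-Gaussian is (up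 to normalization) a q̃-Gaussian. -/
open MeasureTheory Real Matrix
open scoped RealInnerProductSpace

/-- The real `q`-exponential. -/
noncomputable def qExp (q u : ℝ) : ℝ :=
  if q = 1 then Real.exp u
  else if 0 < 1 + (1 - q) * u then (1 + (1 - q) * u) ^ (1 / (1 - q)) else 0

/-- `π_{qd} = (∫_{ℝ^d} exp_q(-‖x‖²) dx)^{2/d}`. -/
noncomputable def piQd (q : ℝ) (d : ℕ) : ℝ :=
  (∫ x : EuclideanSpace ℝ (Fin d), qExp q (-‖x‖ ^ 2)) ^ (2 / (d : ℝ))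

/-- `2_{qd} = d π_{qd}^{d/2} / ∫_{ℝ^d} ‖x‖² exp_q(-‖x‖²) dx`. -/
noncomputable def twoQd (q : ℝ) (d : ℕ) : ℝ :=
  d * piQd q d ^ ((d : ℝ) / 2) /
    ∫ x : EuclideanSpace ℝ (Fin d), ‖x‖ ^ 2 * qExp q (-‖x‖ ^ 2)

/-- The centered `q`-Gaussian density with covariance matrix `S`:
`G_q(x;0,S) = exp_q(-xᵀS⁻¹x / 2_{qd}) / √((2_{qd} π_{qd})^d det S)`. -/
noncomputable def Gq (q : ℝ) (d : ℕ) (S : Matrix (Fin d) (Fin d) ℝ)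
    (x : EuclideanSpace ℝ (Fin d)) : ℝ :=
  qExp q (-(((x : Fin d → ℝ) ⬝ᵥ (S⁻¹ *ᵥ (x : Fin d → ℝ))) / twoQd q d)) /
    Real.sqrt ((twoQd q d * piQd q d) ^ d * S.det)


/-- The Gamma integral `∫ t in Ioi 0, t ^ (a - 1) * exp (-(r * t))` for complex rate `r`. -/
theorem integral_rpow_mul_cexp_neg_mul_Ioi {a : ℝ} (ha : 0 < a) {r : ℂ} (hr : 0 < r.re) :
    ∫ t : ℝ in Set.Ioi 0, ((t ^ (a - 1) : ℝ) : ℂ) * Complex.exp (-(r * t)) =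
      r ^ (-(a : ℂ)) * (Real.Gamma a : ℂ) := by
  set μ : Measure ℝ := (volume.restrict (Set.Ioi 0)).withDensity
    (fun t : ℝ => ENNReal.ofReal (t ^ (a - 1))) with hμ
  have hmeas : Measurable (fun t : ℝ => ENNReal.ofReal (t ^ (a - 1))) := by fun_prop
  have hlt : ∀ᵐ t ∂(volume.restrict (Set.Ioi (0 : ℝ))), ENNReal.ofReal (t ^ (a - 1)) < ⊤ := by simp
  have hmgf (z : ℂ) : ProbabilityTheory.complexMGF id μ z =
      ∫ t : ℝ in Set.Ioi 0, ((t ^ (a - 1) : ℝ) : ℂ) * Complex.exp (z * t) := by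
    rw [ProbabilityTheory.complexMGF, hμ, integral_withDensity_eq_integral_toReal_smul hmeas hlt]
    refine setIntegral_congr_fun measurableSet_Ioi fun t ht => ?_
    have : 0 ≤ t ^ (a - 1) := Real.rpow_nonneg (le_of_lt ht) _
    simp [ENNReal.toReal_ofReal this]
  have hsub : Set.Iio 0 ⊆ ProbabilityTheory.integrableExpSet id μ := by
    intro x hx
    have hx' : 0 < -x := neg_pos.2 hx
    change Integrable _ μ
    rw [hμ, integrable_withDensity_iff_integrable_smul' hmeas hlt]
    have h := integrableOn_rpow_mul_exp_neg_mul_rpow (s := a - 1) (by linarith) one_pos hx'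
    refine IntegrableOn.congr_fun h (fun t ht => ?_) measurableSet_Ioi
    have : 0 ≤ t ^ (a - 1) := Real.rpow_nonneg (le_of_lt ht) _
    simp [ENNReal.toReal_ofReal this]
  have hsub' : {z : ℂ | z.re < 0} ⊆
      {z : ℂ | z.re ∈ interior (ProbabilityTheory.integrableExpSet id μ)} := fun z hz =>
    interior_maximal hsub isOpen_Iio hz
  have han : AnalyticOnNhd ℂ (ProbabilityTheory.complexMGF id μ) {z : ℂ | z.re < 0} :=
    ProbabilityTheory.analyticOnNhd_complexMGF.mono hsub'
  have hopen : IsOpen {z : ℂ | z.re < 0} := isOpen_lt Complex.continuous_re continuous_const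
  have han' : AnalyticOnNhd ℂ (fun z : ℂ => (-z) ^ (-(a : ℂ)) * (Real.Gamma a : ℂ))
      {z : ℂ | z.re < 0} := by
    refine DifferentiableOn.analyticOnNhd (fun z hz => ?_) hopen
    have hz' : z.re < 0 := hz
    refine DifferentiableAt.differentiableWithinAt ?_
    refine DifferentiableAt.mul_const (DifferentiableAt.cpow_const (by fun_prop) ?_) _
    left
    simpa using hz'
  have hpre : IsPreconnected {z : ℂ | z.re < 0} := (convex_halfSpace_re_lt 0).isPreconnected
  have hreal (x : ℝ) (hx : x < 0) : ProbabilityTheory.complexMGF id μ (x : ℂ) =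
      (-(x : ℂ)) ^ (-(a : ℂ)) * (Real.Gamma a : ℂ) := by
    have h := integral_rpow_mul_exp_neg_mul_Ioi ha (neg_pos.2 hx)
    rw [hmgf]
    have e1 : ∫ t : ℝ in Set.Ioi 0, ((t ^ (a - 1) : ℝ) : ℂ) * Complex.exp (x * t) =
        ((∫ t : ℝ in Set.Ioi 0, t ^ (a - 1) * Real.exp (-(-x * t)) : ℝ) : ℂ) := by
      rw [← integral_complex_ofReal]
      refine setIntegral_congr_fun measurableSet_Ioi fun t ht => ?_
      push_cast
      simp
    rw [e1, h, one_div, Real.inv_rpow (neg_pos.2 hx).le, ← Real.rpow_neg (neg_pos.2 hx).le,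
      Complex.ofReal_mul, Complex.ofReal_cpow (neg_pos.2 hx).le]
    push_cast
    rfl
  have hfreq : ∃ᶠ z in nhdsWithin (-1 : ℂ) {-1}ᶜ, ProbabilityTheory.complexMGF id μ z =
      (-z) ^ (-(a : ℂ)) * (Real.Gamma a : ℂ) := by
    have ht : Filter.Tendsto (fun x : ℝ => (x : ℂ)) (nhdsWithin (-1 : ℝ) {-1}ᶜ)
        (nhdsWithin (-1 : ℂ) {-1}ᶜ) := by
      refine tendsto_nhdsWithin_of_tendsto_nhds_of_eventually_within _ ?_ ?_
      · have := (Complex.continuous_ofReal.tendsto (-1 : ℝ)).mono_left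
          (nhdsWithin_le_nhds (s := {-1}ᶜ))
        simpa using this
      · filter_upwards [self_mem_nhdsWithin] with x hx hx'
        have h1 : (x : ℂ) = ((-1 : ℝ) : ℂ) := by simpa using hx'
        exact hx (Complex.ofReal_injective h1)
    refine ht.frequently (Filter.Eventually.frequently ?_)
    filter_upwards [nhdsWithin_le_nhds (Iio_mem_nhds (show (-1 : ℝ) < 0 by norm_num))] with x hx
    exact hreal x hx
  have key := AnalyticOnNhd.eqOn_of_preconnected_of_frequently_eq han han' hpre
    (z₀ := -1) (by simp) hfreq (show -r ∈ {z : ℂ | z.re < 0} by simpa using hr)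
  rw [hmgf] at key
  simpa using key

theorem integrable_one_add_sq_norm_rpow_neg {d : ℕ} {a : ℝ} (ha : (d : ℝ) / 2 < a) :
    Integrable (fun z : EuclideanSpace ℝ (Fin d) => (1 + ‖z‖ ^ 2) ^ (-a)) := by
  have h := integrable_rpow_neg_one_add_norm_sq (E := EuclideanSpace ℝ (Fin d)) (μ := volume)
    (r := 2 * a) (by rw [finrank_euclideanSpace_fin]; linarith)
  convert h using 3
  ring

theorem integrable_prod_rpow_mul_cexp {d : ℕ} {a : ℝ} (ha : (d : ℝ) / 2 < a)
    (w : EuclideanSpace ℝ (Fin d)) :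
    Integrable (Function.uncurry fun (z : EuclideanSpace ℝ (Fin d)) (t : ℝ) =>
      ((t ^ (a - 1) : ℝ) : ℂ) *
        Complex.exp (-((1 + (‖z‖ : ℂ) ^ 2 - 2 * Complex.I * ((⟪w, z⟫ : ℝ) : ℂ)) * t)))
      (volume.prod (volume.restrict (Set.Ioi (0 : ℝ)))) := by
  have ha0 : 0 < a := lt_of_le_of_lt (by positivity) ha
  have hnorm (z : EuclideanSpace ℝ (Fin d)) (t : ℝ) (ht : t ∈ Set.Ioi (0 : ℝ)) :
      ‖((t ^ (a - 1) : ℝ) : ℂ) *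
        Complex.exp (-((1 + (‖z‖ : ℂ) ^ 2 - 2 * Complex.I * ((⟪w, z⟫ : ℝ) : ℂ)) * t))‖ =
      t ^ (a - 1) * Real.exp (-((1 + ‖z‖ ^ 2) * t)) := by
    have : 0 ≤ t ^ (a - 1) := Real.rpow_nonneg (le_of_lt ht) _
    rw [norm_mul, Complex.norm_real, Real.norm_of_nonneg this, Complex.norm_exp]
    congr 2
    simp [← Complex.ofReal_pow]
  have hmeas : AEStronglyMeasurable
      (Function.uncurry fun (z : EuclideanSpace ℝ (Fin d)) (t : ℝ) => ((t ^ (a - 1) : ℝ) : ℂ) *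
        Complex.exp (-((1 + (‖z‖ : ℂ) ^ 2 - 2 * Complex.I * ((⟪w, z⟫ : ℝ) : ℂ)) * t)))
      (volume.prod (volume.restrict (Set.Ioi (0 : ℝ)))) := by
    refine Measurable.aestronglyMeasurable ?_
    unfold Function.uncurry
    fun_prop
  rw [integrable_prod_iff hmeas]
  constructor
  · refine Filter.Eventually.of_forall fun z => ?_
    have hz : 0 < 1 + ‖z‖ ^ 2 := by positivity
    have h := integrableOn_rpow_mul_exp_neg_mul_rpow (s := a - 1) (by linarith) one_pos hz
    refine Integrable.mono' h (by unfold Function.uncurry; fun_prop) ?_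
    filter_upwards [ae_restrict_mem measurableSet_Ioi] with t ht
    simp only [Function.uncurry]
    rw [hnorm z t ht, Real.rpow_one, neg_mul]
  · have he : (fun z : EuclideanSpace ℝ (Fin d) => (1 + ‖z‖ ^ 2) ^ (-a) * Real.Gamma a) =
        fun z => ∫ t : ℝ in Set.Ioi 0, ‖Function.uncurry
          (fun (z : EuclideanSpace ℝ (Fin d)) (t : ℝ) => ((t ^ (a - 1) : ℝ) : ℂ) *
          Complex.exp (-((1 + (‖z‖ : ℂ) ^ 2 - 2 * Complex.I * ((⟪w, z⟫ : ℝ) : ℂ)) * t))) (z, t)‖ := by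
      funext z
      have hz : 0 < 1 + ‖z‖ ^ 2 := by positivity
      have h := Real.integral_rpow_mul_exp_neg_mul_Ioi ha0 hz
      rw [one_div, Real.inv_rpow hz.le, ← Real.rpow_neg hz.le] at h
      rw [← h]
      exact setIntegral_congr_fun measurableSet_Ioi fun t ht => (hnorm z t ht).symm
    rw [← he]
    exact (integrable_one_add_sq_norm_rpow_neg ha).mul_const _

theorem integral_one_add_sq_norm_sub_inner_cpow_mul_Gamma {d : ℕ} {a : ℝ} (ha : (d : ℝ) / 2 < a)
    (w : EuclideanSpace ℝ (Fin d)) :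
    (∫ z : EuclideanSpace ℝ (Fin d),
        (1 + (‖z‖ : ℂ) ^ 2 - 2 * Complex.I * ((⟪w, z⟫ : ℝ) : ℂ)) ^ (-(a : ℂ))) *
          (Real.Gamma a : ℂ) =
      ((π ^ ((d : ℝ) / 2) * Real.Gamma (a - d / 2) * (1 + ‖w‖ ^ 2) ^ ((d : ℝ) / 2 - a) : ℝ) : ℂ) := by
  have ha0 : 0 < a := lt_of_le_of_lt (by positivity) ha
  have hw : 0 < 1 + ‖w‖ ^ 2 := by positivity
  rw [← integral_mul_const]
  have h1 (z : EuclideanSpace ℝ (Fin d)) :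
      (1 + (‖z‖ : ℂ) ^ 2 - 2 * Complex.I * ((⟪w, z⟫ : ℝ) : ℂ)) ^ (-(a : ℂ)) * (Real.Gamma a : ℂ) =
      ∫ t : ℝ in Set.Ioi 0, ((t ^ (a - 1) : ℝ) : ℂ) *
        Complex.exp (-((1 + (‖z‖ : ℂ) ^ 2 - 2 * Complex.I * ((⟪w, z⟫ : ℝ) : ℂ)) * t)) := by
    refine (integral_rpow_mul_cexp_neg_mul_Ioi ha0 ?_).symm
    have hz : 0 < 1 + ‖z‖ ^ 2 := by positivity
    simpa [← Complex.ofReal_pow] using hz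
  simp_rw [h1]
  rw [integral_integral_swap (integrable_prod_rpow_mul_cexp ha w)]
  have h2 : ∀ t ∈ Set.Ioi (0 : ℝ), (∫ z : EuclideanSpace ℝ (Fin d), ((t ^ (a - 1) : ℝ) : ℂ) *
        Complex.exp (-((1 + (‖z‖ : ℂ) ^ 2 - 2 * Complex.I * ((⟪w, z⟫ : ℝ) : ℂ)) * t))) =
      ((π ^ ((d : ℝ) / 2) * (t ^ (a - d / 2 - 1) * Real.exp (-((1 + ‖w‖ ^ 2) * t))) : ℝ) : ℂ) := by
    intro t ht
    have ht' : 0 < t := ht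
    have hg := GaussianFourier.integral_cexp_neg_mul_sq_norm_add (b := (t : ℂ))
      (by simpa using ht') (2 * Complex.I * t) w
    have h3 (z : EuclideanSpace ℝ (Fin d)) : ((t ^ (a - 1) : ℝ) : ℂ) *
        Complex.exp (-((1 + (‖z‖ : ℂ) ^ 2 - 2 * Complex.I * ((⟪w, z⟫ : ℝ) : ℂ)) * t)) =
        (((t ^ (a - 1) : ℝ) : ℂ) * Complex.exp (-t)) *
        Complex.exp (-t * (‖z‖ : ℂ) ^ 2 + 2 * Complex.I * t * ((⟪w, z⟫ : ℝ) : ℂ)) := by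
      rw [mul_assoc (((t ^ (a - 1) : ℝ) : ℂ)), ← Complex.exp_add]
      congr 2
      ring
    simp_rw [h3]
    rw [integral_const_mul, hg, finrank_euclideanSpace_fin]
    have h4 : ((π : ℂ) / t) ^ ((d : ℂ) / 2) =
        ((π ^ ((d : ℝ) / 2) * t ^ (-((d : ℝ) / 2)) : ℝ) : ℂ) := by
      rw [Real.rpow_neg ht'.le, ← div_eq_mul_inv, ← Real.div_rpow pi_pos.le ht'.le,
        Complex.ofReal_cpow (by positivity)]
      push_cast
      rfl
    have h5 : (2 * Complex.I * (t : ℂ)) ^ 2 * (‖w‖ : ℂ) ^ 2 / (4 * t) =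
        ((-(‖w‖ ^ 2 * t) : ℝ) : ℂ) := by
      have : (t : ℂ) ≠ 0 := by exact_mod_cast ht'.ne'
      field_simp
      push_cast
      linear_combination 4 * (t : ℂ) * ‖w‖ ^ 2 * Complex.I_sq
    rw [h4, h5, ← Complex.ofReal_neg, ← Complex.ofReal_exp, ← Complex.ofReal_exp]
    norm_cast
    rw [show -((1 + ‖w‖ ^ 2) * t) = -t + -(‖w‖ ^ 2 * t) by ring, Real.exp_add,
      show a - d / 2 - 1 = (a - 1) + -((d : ℝ) / 2) by ring, Real.rpow_add ht']
    ring
  rw [setIntegral_congr_fun measurableSet_Ioi h2, integral_complex_ofReal, integral_const_mul,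
    Real.integral_rpow_mul_exp_neg_mul_Ioi (sub_pos.2 ha) hw, one_div, Real.inv_rpow hw.le,
    ← Real.rpow_neg hw.le, neg_sub]
  congr 1
  ring

theorem integral_one_add_sq_norm_sub_inner_cpow {d : ℕ} {a : ℝ} (ha : (d : ℝ) / 2 < a)
    (w : EuclideanSpace ℝ (Fin d)) :
    ∫ z : EuclideanSpace ℝ (Fin d),
        (1 + (‖z‖ : ℂ) ^ 2 - 2 * Complex.I * ((⟪w, z⟫ : ℝ) : ℂ)) ^ (-(a : ℂ)) =
      (((∫ z : EuclideanSpace ℝ (Fin d), (1 + ‖z‖ ^ 2) ^ (-a)) *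
        (1 + ‖w‖ ^ 2) ^ ((d : ℝ) / 2 - a) : ℝ) : ℂ) := by
  have ha0 : 0 < a := lt_of_le_of_lt (by positivity) ha
  have hG : (Real.Gamma a : ℂ) ≠ 0 := by exact_mod_cast (Real.Gamma_pos_of_pos ha0).ne'
  refine mul_right_cancel₀ hG ?_
  have h0 := integral_one_add_sq_norm_sub_inner_cpow_mul_Gamma ha (0 : EuclideanSpace ℝ (Fin d))
  have h1 : (∫ z : EuclideanSpace ℝ (Fin d),
        (1 + (‖z‖ : ℂ) ^ 2 - 2 * Complex.I * ((⟪(0 : EuclideanSpace ℝ (Fin d)), z⟫ : ℝ) : ℂ)) ^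
          (-(a : ℂ))) = ((∫ z : EuclideanSpace ℝ (Fin d), (1 + ‖z‖ ^ 2) ^ (-a) : ℝ) : ℂ) := by
    rw [← integral_complex_ofReal]
    refine integral_congr_ae (Filter.Eventually.of_forall fun z => ?_)
    simp only
    rw [Complex.ofReal_cpow (by positivity)]
    simp
  rw [h1] at h0
  rw [integral_one_add_sq_norm_sub_inner_cpow_mul_Gamma ha w, Complex.ofReal_mul (∫ z, _),
    mul_right_comm (Complex.ofReal (∫ z, _)), h0, ← Complex.ofReal_mul]
  simp

open scoped MatrixOrder in
theorem Matrix.PosDef.exists_transpose_mul_self {d : ℕ} {M : Matrix (Fin d) (Fin d) ℝ}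
    (hM : M.PosDef) : ∃ B : Matrix (Fin d) (Fin d) ℝ, M = Bᵀ * B := by
  obtain ⟨B, hB⟩ := CStarAlgebra.nonneg_iff_eq_star_mul_self.mp hM.posSemidef.nonneg
  exact ⟨B, by simpa [Matrix.star_eq_conjTranspose] using hB⟩

theorem integral_comp_toEuclideanLin {d : ℕ} {R : Matrix (Fin d) (Fin d) ℝ} (hR : R.det ≠ 0)
    (g : EuclideanSpace ℝ (Fin d) → ℂ) :
    ∫ x, g x = ((|R.det| : ℝ) : ℂ) * ∫ y, g (toEuclideanLin R y) := by
  have hdet : LinearMap.det (toEuclideanLin R) = R.det := by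
    have h : toEuclideanLin R =
        Matrix.toLin (PiLp.basisFun 2 ℝ (Fin d)) (PiLp.basisFun 2 ℝ (Fin d)) R := by
      rw [← Matrix.toLpLin_eq_toLin]
    rw [h, LinearMap.det_toLin]
  have hf : LinearMap.det (toEuclideanLin R) ≠ 0 := by rwa [hdet]
  have hmap := Measure.map_linearMap_addHaar_eq_smul_addHaar
    (volume : Measure (EuclideanSpace ℝ (Fin d))) hf
  have hemb : MeasurableEmbedding (toEuclideanLin R) :=
    ((toEuclideanLin R).equivOfDetNeZero hf).toContinuousLinearEquiv.toHomeomorph.measurableEmbedding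
  have h := hemb.integral_map (μ := volume) g
  rw [hmap, integral_smul_measure, ENNReal.toReal_ofReal (abs_nonneg _), hdet] at h
  rw [← h, abs_inv, Complex.real_smul, ← mul_assoc, ← Complex.ofReal_mul,
    mul_inv_cancel₀ (abs_ne_zero.2 hR)]
  simp

theorem integral_one_add_dotProduct_inv_mulVec_sub_inner_cpow {d : ℕ} {a : ℝ}
    (ha : (d : ℝ) / 2 < a) {M : Matrix (Fin d) (Fin d) ℝ} (hM : M.PosDef)
    (k : EuclideanSpace ℝ (Fin d)) :
    ∫ x : EuclideanSpace ℝ (Fin d),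
        (1 + (((x : Fin d → ℝ) ⬝ᵥ (M⁻¹ *ᵥ (x : Fin d → ℝ)) : ℝ) : ℂ) -
          2 * Complex.I * ((⟪k, x⟫ : ℝ) : ℂ)) ^ (-(a : ℂ)) =
      ((√M.det * (∫ z : EuclideanSpace ℝ (Fin d), (1 + ‖z‖ ^ 2) ^ (-a)) *
        (1 + (k : Fin d → ℝ) ⬝ᵥ (M *ᵥ (k : Fin d → ℝ))) ^ ((d : ℝ) / 2 - a) : ℝ) : ℂ) := by
  obtain ⟨B, rfl⟩ := hM.exists_transpose_mul_self
  have hdet : (Bᵀ * B).det = B.det ^ 2 := by rw [det_mul, det_transpose, sq]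
  have hB : B.det ≠ 0 := by
    intro h
    have := hM.det_pos
    rw [hdet, h] at this
    simp at this
  have hBu : IsUnit B.det := isUnit_iff_ne_zero.2 hB
  rw [integral_comp_toEuclideanLin (R := Bᵀ) (by rwa [det_transpose])]
  have hq (y : EuclideanSpace ℝ (Fin d)) :
      ((toEuclideanLin Bᵀ y : EuclideanSpace ℝ (Fin d)) : Fin d → ℝ) ⬝ᵥ
        ((Bᵀ * B)⁻¹ *ᵥ ((toEuclideanLin Bᵀ y : EuclideanSpace ℝ (Fin d)) : Fin d → ℝ)) =
        ‖y‖ ^ 2 := by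
    rw [EuclideanSpace.real_norm_sq_eq, Matrix.toLpLin_apply, WithLp.ofLp_toLp,
      mulVec_mulVec, Matrix.mul_inv_rev, Matrix.mul_assoc,
      Matrix.nonsing_inv_mul _ (by rwa [det_transpose]), Matrix.mul_one, dotProduct_mulVec,
      ← mulVec_transpose, mulVec_mulVec, ← Matrix.transpose_mul, Matrix.mul_nonsing_inv _ hBu]
    simp [dotProduct, sq]
  have hk (y : EuclideanSpace ℝ (Fin d)) :
      ⟪k, toEuclideanLin Bᵀ y⟫ = ⟪toEuclideanLin B k, y⟫ := by
    rw [← Matrix.conjTranspose_eq_transpose_of_trivial,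
      Matrix.toEuclideanLin_conjTranspose_eq_adjoint, LinearMap.adjoint_inner_right]
  have hn : ‖toEuclideanLin B k‖ ^ 2 = (k : Fin d → ℝ) ⬝ᵥ ((Bᵀ * B) *ᵥ (k : Fin d → ℝ)) := by
    rw [← mulVec_mulVec, dotProduct_mulVec, vecMul_transpose, EuclideanSpace.real_norm_sq_eq]
    simp [dotProduct, sq, Matrix.toLpLin_apply]
  simp_rw [hq, hk]
  have h := integral_one_add_sq_norm_sub_inner_cpow ha (toEuclideanLin B k)
  rw [hn] at h
  simp only [Complex.ofReal_pow]
  rw [h, hdet, Real.sqrt_sq_eq_abs, det_transpose, ← Complex.ofReal_mul, mul_assoc]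

theorem qExp_neg_of_one_lt {q : ℝ} (hq : 1 < q) {u : ℝ} (hu : 0 ≤ u) :
    qExp q (-u) = (1 + (q - 1) * u) ^ (-(1 / (q - 1))) := by
  have h : 0 ≤ (q - 1) * u := mul_nonneg (sub_pos.2 hq).le hu
  rw [qExp, if_neg hq.ne', show (1 - q) * -u = (q - 1) * u by ring, if_pos (by linarith),
    ← neg_sub q 1, one_div_neg_eq_neg_one_div]

theorem integral_one_add_sq_norm_rpow_neg_pos {d : ℕ} {a : ℝ} (ha : (d : ℝ) / 2 < a) :
    0 < ∫ z : EuclideanSpace ℝ (Fin d), (1 + ‖z‖ ^ 2) ^ (-a) := by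
  refine integral_pos_of_integrable_nonneg_nonzero (x := 0) ?_
    (integrable_one_add_sq_norm_rpow_neg ha) (fun z => by positivity) (by simp)
  exact Continuous.rpow_const (by fun_prop) fun z => Or.inl (by positivity)

theorem integral_qExp_neg_sq_norm {d : ℕ} {q : ℝ} (hq : 1 < q) :
    ∫ x : EuclideanSpace ℝ (Fin d), qExp q (-‖x‖ ^ 2) =
      (√(q - 1) ^ d)⁻¹ * ∫ z : EuclideanSpace ℝ (Fin d), (1 + ‖z‖ ^ 2) ^ (-(1 / (q - 1))) := by
  have h := Measure.integral_comp_smul (volume : Measure (EuclideanSpace ℝ (Fin d)))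
    (fun z => (1 + ‖z‖ ^ 2) ^ (-(1 / (q - 1)))) √(q - 1)
  rw [finrank_euclideanSpace_fin, abs_of_nonneg (by positivity), smul_eq_mul] at h
  rw [← h]
  congr 1
  funext x
  rw [qExp_neg_of_one_lt hq (by positivity), norm_smul, Real.norm_of_nonneg (Real.sqrt_nonneg _),
    mul_pow, Real.sq_sqrt (sub_pos.2 hq).le]

theorem half_dim_add_one_lt_one_div {d : ℕ} {q : ℝ} (hq1 : 1 < q)
    (hq2 : q < ((d : ℝ) + 4) / ((d : ℝ) + 2)) : (d : ℝ) / 2 + 1 < 1 / (q - 1) := by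
  have h0 : 0 < q - 1 := sub_pos.2 hq1
  rw [lt_div_iff₀ (by positivity)] at hq2
  rw [lt_div_iff₀ h0]
  linarith

theorem integral_sq_norm_mul_qExp_pos {d : ℕ} (hd : 1 ≤ d) {q : ℝ} (hq1 : 1 < q)
    (hq2 : q < ((d : ℝ) + 4) / ((d : ℝ) + 2)) :
    0 < ∫ x : EuclideanSpace ℝ (Fin d), ‖x‖ ^ 2 * qExp q (-‖x‖ ^ 2) := by
  have h0 : 0 < q - 1 := sub_pos.2 hq1
  have ha := half_dim_add_one_lt_one_div hq1 hq2
  set a := 1 / (q - 1) with ha_def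
  have ha0 : 0 < a := by positivity
  have hq3 : q - 1 ≤ 1 := by
    rw [ha_def, lt_div_iff₀ h0] at ha
    have : (0 : ℝ) ≤ (d : ℝ) / 2 * (q - 1) := by positivity
    linarith
  have he (x : EuclideanSpace ℝ (Fin d)) :
      qExp q (-‖x‖ ^ 2) = (1 + (q - 1) * ‖x‖ ^ 2) ^ (-a) :=
    qExp_neg_of_one_lt hq1 (by positivity)
  simp_rw [he]
  have hcont : Continuous fun x : EuclideanSpace ℝ (Fin d) =>
      ‖x‖ ^ 2 * (1 + (q - 1) * ‖x‖ ^ 2) ^ (-a) :=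
    Continuous.mul (by fun_prop)
      (Continuous.rpow_const (by fun_prop) fun z => Or.inl (by positivity))
  have hint : Integrable fun x : EuclideanSpace ℝ (Fin d) =>
      ‖x‖ ^ 2 * (1 + (q - 1) * ‖x‖ ^ 2) ^ (-a) := by
    refine Integrable.mono' ((integrable_one_add_sq_norm_rpow_neg (d := d) (a := a - 1)
      (by linarith)).const_mul ((q - 1) ^ (-a))) hcont.aestronglyMeasurable
      (Filter.Eventually.of_forall fun x => ?_)
    have hx : 0 < 1 + ‖x‖ ^ 2 := by positivity
    rw [Real.norm_of_nonneg (by positivity)]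
    calc ‖x‖ ^ 2 * (1 + (q - 1) * ‖x‖ ^ 2) ^ (-a)
        ≤ (1 + ‖x‖ ^ 2) * ((q - 1) * (1 + ‖x‖ ^ 2)) ^ (-a) := by
          refine mul_le_mul (by linarith) ?_ (by positivity) hx.le
          exact Real.rpow_le_rpow_of_nonpos (by positivity) (by linarith) (by linarith)
      _ = (q - 1) ^ (-a) * (1 + ‖x‖ ^ 2) ^ (-(a - 1)) := by
          rw [Real.mul_rpow h0.le hx.le, show -(a - 1) = 1 + -a by ring, Real.rpow_add hx,
            Real.rpow_one]
          ring
  have : Nonempty (Fin d) := ⟨⟨0, hd⟩⟩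
  obtain ⟨x, hx⟩ := exists_ne (0 : EuclideanSpace ℝ (Fin d))
  have hx' : 0 < ‖x‖ := norm_pos_iff.2 hx
  exact integral_pos_of_integrable_nonneg_nonzero (x := x) hcont hint (fun z => by positivity)
    (by positivity)

theorem piQd_pos {d : ℕ} {q : ℝ} (hq1 : 1 < q) (hq2 : q < ((d : ℝ) + 4) / ((d : ℝ) + 2)) :
    0 < piQd q d := by
  have ha := half_dim_add_one_lt_one_div hq1 hq2
  have h0 : 0 < q - 1 := sub_pos.2 hq1
  rw [piQd, integral_qExp_neg_sq_norm hq1]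
  have := integral_one_add_sq_norm_rpow_neg_pos (d := d) (a := 1 / (q - 1)) (by linarith)
  positivity

theorem piQd_pow_mul {d : ℕ} (hd : 1 ≤ d) {q : ℝ} (hq1 : 1 < q)
    (hq2 : q < ((d : ℝ) + 4) / ((d : ℝ) + 2)) :
    (piQd q d * (q - 1)) ^ d =
      (∫ z : EuclideanSpace ℝ (Fin d), (1 + ‖z‖ ^ 2) ^ (-(1 / (q - 1)))) ^ 2 := by
  have ha := half_dim_add_one_lt_one_div hq1 hq2
  have h0 : 0 < q - 1 := sub_pos.2 hq1
  have hpos := integral_one_add_sq_norm_rpow_neg_pos (d := d) (a := 1 / (q - 1)) (by linarith)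
  have hd' : (d : ℝ) ≠ 0 := by positivity
  rw [piQd, integral_qExp_neg_sq_norm hq1, mul_pow, ← Real.rpow_mul_natCast (by positivity),
    div_mul_cancel₀ _ hd', Real.rpow_two, mul_pow, inv_pow, ← pow_mul, mul_comm d 2, pow_mul,
    Real.sq_sqrt h0.le]
  field_simp

theorem twoQd_pos {d : ℕ} (hd : 1 ≤ d) {q : ℝ} (hq1 : 1 < q)
    (hq2 : q < ((d : ℝ) + 4) / ((d : ℝ) + 2)) : 0 < twoQd q d := by
  have h1 := piQd_pos hq1 hq2
  have h2 := integral_sq_norm_mul_qExp_pos hd hq1 hq2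
  rw [twoQd]
  positivity

theorem ofReal_rpow_mul_cpow_ofReal {w : ℝ} (hw : 0 < w) (z : ℂ) (r : ℝ) :
    ((w ^ r : ℝ) : ℂ) * z ^ (r : ℂ) = (w * z) ^ (r : ℂ) := by
  rcases eq_or_ne z 0 with rfl | hz
  · rcases eq_or_ne r 0 with rfl | hr
    · simp
    · have : (r : ℂ) ≠ 0 := by exact_mod_cast hr
      simp [Complex.zero_cpow this]
  have hw' : (w : ℂ) ≠ 0 := by exact_mod_cast hw.ne'
  rw [Complex.ofReal_cpow hw.le, Complex.cpow_def_of_ne_zero hw', Complex.cpow_def_of_ne_zero hz,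
    Complex.cpow_def_of_ne_zero (mul_ne_zero hw' hz), Complex.log_ofReal_mul hw hz,
    ← Complex.exp_add, ← Complex.ofReal_log hw.le, add_mul]

/-- multivariate q-Fourier transform of a q-Gaussian:
for `1 < q < (d+4)/(d+2)` and `Σ` symmetric positive definite,
`∫ G_q(x;0,Σ) exp_q(i(k·x)G_q(x;0,Σ)^{q-1}) dx
  = exp_{q̃}(-(2_{qd}[2+d(1-q)]/(8(2_{qd}π_{qd})^{d(q-1)})) (kᵀΣk)/(detΣ)^{q-1})`,
with `q̃ = [2+(d-2)(1-q)]/[2+d(1-q)]`. -/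
theorem stmt4 (d : ℕ) (hd : 1 ≤ d) (q : ℝ) (hq1 : 1 < q)
    (hq2 : q < ((d : ℝ) + 4) / ((d : ℝ) + 2))
    (S : Matrix (Fin d) (Fin d) ℝ) (hS : S.PosDef) (hSsymm : S.IsSymm)
    (k : EuclideanSpace ℝ (Fin d))
    (qt : ℝ) (hqt : qt = (2 + ((d : ℝ) - 2) * (1 - q)) / (2 + (d : ℝ) * (1 - q))) :
    (∫ x : EuclideanSpace ℝ (Fin d), (Gq q d S x : ℂ) *
        qExpC q (Complex.I * ((⟪k, x⟫ : ℝ) : ℂ) * ((Gq q d S x ^ (q - 1) : ℝ) : ℂ))) =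
      ((qExp qt (-(twoQd q d * (2 + (d : ℝ) * (1 - q)) /
          (8 * (twoQd q d * piQd q d) ^ ((d : ℝ) * (q - 1))) *
          (((k : Fin d → ℝ) ⬝ᵥ (S *ᵥ (k : Fin d → ℝ))) / S.det ^ (q - 1)))) : ℝ) : ℂ) := by
  have h0 : 0 < q - 1 := sub_pos.2 hq1
  have hT := twoQd_pos hd hq1 hq2
  have hP := piQd_pos hq1 hq2
  have hPM := piQd_pow_mul hd hq1 hq2
  have ha := half_dim_add_one_lt_one_div hq1 hq2
  have hMpos := integral_one_add_sq_norm_rpow_neg_pos (d := d) (a := 1 / (q - 1)) (by linarith)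
  have hdet := hS.det_pos
  set T := twoQd q d
  set P := piQd q d
  set a := 1 / (q - 1) with ha_def
  set D := (T * P) ^ d * S.det with hD
  have hDpos : 0 < D := by positivity
  set s := √D ^ (-(q - 1)) with hs
  have hspos : 0 < s := by positivity
  have hc : 0 < T / (q - 1) := by positivity
  have hM : ((T / (q - 1)) • S).PosDef := hS.smul hc
  have hinv : ((T / (q - 1)) • S)⁻¹ = ((q - 1) / T) • S⁻¹ := by
    refine Matrix.inv_eq_right_inv ?_
    rw [Matrix.smul_mul, Matrix.mul_smul, smul_smul,
      Matrix.mul_nonsing_inv _ (isUnit_iff_ne_zero.2 hdet.ne')]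
    rw [div_mul_div_comm, mul_comm, div_self (by positivity), one_smul]
  have hG (x : EuclideanSpace ℝ (Fin d)) : Gq q d S x =
      (√D)⁻¹ * (1 + (x : Fin d → ℝ) ⬝ᵥ (((T / (q - 1)) • S)⁻¹ *ᵥ (x : Fin d → ℝ))) ^ (-a) ∧
      0 < 1 + (x : Fin d → ℝ) ⬝ᵥ (((T / (q - 1)) • S)⁻¹ *ᵥ (x : Fin d → ℝ)) := by
    have hx : 0 ≤ (x : Fin d → ℝ) ⬝ᵥ (S⁻¹ *ᵥ (x : Fin d → ℝ)) := by
      simpa using hS.inv.posSemidef.dotProduct_mulVec_nonneg (x : Fin d → ℝ)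
    have e : (x : Fin d → ℝ) ⬝ᵥ (((T / (q - 1)) • S)⁻¹ *ᵥ (x : Fin d → ℝ)) =
        (q - 1) * ((x : Fin d → ℝ) ⬝ᵥ (S⁻¹ *ᵥ (x : Fin d → ℝ)) / T) := by
      rw [hinv, smul_mulVec, dotProduct_smul, smul_eq_mul]
      ring
    constructor
    · rw [Gq, qExp_neg_of_one_lt hq1 (by positivity), e, div_eq_inv_mul]
    · rw [e]
      positivity
  have hint (x : EuclideanSpace ℝ (Fin d)) : (Gq q d S x : ℂ) *
        qExpC q (Complex.I * ((⟪k, x⟫ : ℝ) : ℂ) * ((Gq q d S x ^ (q - 1) : ℝ) : ℂ)) =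
      (((√D)⁻¹ : ℝ) : ℂ) *
        (1 + (((x : Fin d → ℝ) ⬝ᵥ (((T / (q - 1)) • S)⁻¹ *ᵥ (x : Fin d → ℝ)) : ℝ) : ℂ) -
          2 * Complex.I * ((⟪((q - 1) * s / 2) • k, x⟫ : ℝ) : ℂ)) ^ (-(a : ℂ)) := by
    obtain ⟨h1, hw⟩ := hG x
    rw [h1]
    set v := (x : Fin d → ℝ) ⬝ᵥ (((T / (q - 1)) • S)⁻¹ *ᵥ (x : Fin d → ℝ))
    have hpow : ((√D)⁻¹ * (1 + v) ^ (-a)) ^ (q - 1) = s * (1 + v)⁻¹ := by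
      rw [Real.mul_rpow (by positivity) (by positivity), ← Real.rpow_mul hw.le, ha_def, neg_mul,
        one_div_mul_cancel h0.ne', Real.rpow_neg_one, Real.inv_rpow (by positivity), hs,
        Real.rpow_neg (by positivity)]
    have hexp : (1 / (1 - q) : ℂ) = ((-a : ℝ) : ℂ) := by
      rw [ha_def, ← one_div_neg_eq_neg_one_div, neg_sub]
      push_cast
      rfl
    rw [hpow, qExpC, if_neg hq1.ne', hexp, Complex.ofReal_mul, mul_assoc,
      ofReal_rpow_mul_cpow_ofReal hw, Complex.ofReal_neg, real_inner_smul_left]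
    congr 2
    have hw' : (1 : ℂ) + v ≠ 0 := by exact_mod_cast hw.ne'
    push_cast
    field_simp
    ring
  simp_rw [hint]
  rw [integral_const_mul, integral_one_add_dotProduct_inv_mulVec_sub_inner_cpow (by linarith) hM,
    ← Complex.ofReal_mul]
  congr 1
  have hnorm : √((T / (q - 1)) • S).det *
      (∫ z : EuclideanSpace ℝ (Fin d), (1 + ‖z‖ ^ 2) ^ (-a)) = √D := by
    rw [← Real.sqrt_sq hMpos.le, ← Real.sqrt_mul hM.det_pos.le, ← hPM, det_smul, Fintype.card_fin,
      hD]
    congr 1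
    rw [mul_right_comm, ← mul_pow]
    congr 2
    field_simp
  rw [hnorm, inv_mul_cancel_left₀ (Real.sqrt_pos.2 hDpos).ne']
  have hden : 0 < 2 + (d : ℝ) * (1 - q) := by
    rw [lt_div_iff₀ h0] at ha
    linarith
  have h1qt : 1 - qt = 2 * (1 - q) / (2 + (d : ℝ) * (1 - q)) := by
    rw [hqt]
    field_simp
    ring
  have hqt1 : 1 < qt := by
    have : 1 - qt < 0 := by
      rw [h1qt]
      exact div_neg_of_neg_of_pos (by linarith) hden
    linarith
  have hk : 0 ≤ (k : Fin d → ℝ) ⬝ᵥ (S *ᵥ (k : Fin d → ℝ)) := by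
    simpa using hS.posSemidef.dotProduct_mulVec_nonneg (k : Fin d → ℝ)
  have hs2 : s ^ 2 = ((T * P) ^ ((d : ℝ) * (q - 1)) * S.det ^ (q - 1))⁻¹ := by
    rw [hs, ← Real.rpow_mul_natCast (by positivity), mul_comm, Real.rpow_mul (by positivity)]
    rw [show ((2 : ℕ) : ℝ) = 2 by norm_num, Real.rpow_two, Real.sq_sqrt hDpos.le,
      Real.rpow_neg hDpos.le, hD, Real.mul_rpow (by positivity) hdet.le,
      ← Real.rpow_natCast_mul (by positivity)]
  rw [qExp_neg_of_one_lt hqt1 (by positivity)]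
  congr 1
  · rw [WithLp.ofLp_smul, smul_mulVec, mulVec_smul, dotProduct_smul, smul_dotProduct,
      dotProduct_smul]
    simp only [smul_eq_mul]
    have : qt - 1 = 2 * (q - 1) / (2 + (d : ℝ) * (1 - q)) := by
      rw [← neg_sub 1 qt, h1qt]
      ring
    rw [this]
    have hX : 0 < (T * P) ^ ((d : ℝ) * (q - 1)) := by positivity
    have hY : 0 < S.det ^ (q - 1) := by positivity
    calc _ = 1 + s ^ 2 * ((q - 1) * T / 4 * ((k : Fin d → ℝ) ⬝ᵥ (S *ᵥ (k : Fin d → ℝ)))) := by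
          field_simp
          ring
      _ = _ := by
          rw [hs2]
          field_simp
          ring
  · rw [← neg_sub 1 qt, h1qt, ha_def]
    have : (1 - q) ≠ 0 := by linarith
    rw [← neg_sub 1 q]
    field_simp
    ring
end

section
/- Closed form of the deformed exponential Exp_ϑ for η = λ = 1: let d ≥ 1 be an integer and 1 < q < (d+4)/(d+2). Then for every real w ≥ 0 and every unit vector v ∈ ℝ^d, π_{qd}^{-d/2} ∫_{ℝ^d} exp_q(-‖u‖²) · [1 - 2i√w (q-1)(v·u)/(1+(q-1)‖u‖²)]^{1/(1-q)} du = exp_{q̃}( -[2+d(1-q)] w / 2 ), where q̃ = [2+(d-2)(1-q)] / [2+d(1-q)]. In particular the left-hand integral is real-valued. -/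
open MeasureTheory Real
open scoped RealInnerProductSpace

/-- The Laplace transform of a power, at a complex point of the right half-plane. -/
lemma integral_rpow_mul_cexp_neg_mul_Ioi_s5 {s : ℝ} (hs : 0 < s) {z : ℂ} (hz : 0 < z.re) :
    ∫ t in Set.Ioi (0 : ℝ), ((t ^ (s - 1) : ℝ) : ℂ) * Complex.exp (-(z * t)) =
      z ^ (-s : ℂ) * Real.Gamma s := by
  set μ : Measure ℝ :=
    (volume.restrict (Set.Ioi 0)).withDensity (fun t => ENNReal.ofReal (t ^ (s - 1))) with hμ
  have hmeas : Measurable fun t : ℝ => ENNReal.ofReal (t ^ (s - 1)) := by fun_prop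
  have hpos : ∀ t ∈ Set.Ioi (0 : ℝ), (ENNReal.ofReal (t ^ (s - 1))).toReal = t ^ (s - 1) :=
    fun t ht => ENNReal.toReal_ofReal (Real.rpow_nonneg (le_of_lt ht) _)
  have hF : ∀ ζ : ℂ, ProbabilityTheory.complexMGF (fun t : ℝ => -t) μ ζ =
      ∫ t in Set.Ioi (0 : ℝ), ((t ^ (s - 1) : ℝ) : ℂ) * Complex.exp (-(ζ * t)) := by
    intro ζ
    rw [ProbabilityTheory.complexMGF, hμ,
      integral_withDensity_eq_integral_toReal_smul hmeas (by simp)]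
    refine setIntegral_congr_fun measurableSet_Ioi fun t ht => ?_
    simp only [hpos t ht, Complex.real_smul, Complex.ofReal_neg, mul_neg]
  have hset : Set.Ioi (0 : ℝ) ⊆
      interior (ProbabilityTheory.integrableExpSet (fun t : ℝ => -t) μ) := by
    refine interior_maximal (fun r hr => ?_) isOpen_Ioi
    change Integrable (fun t : ℝ => rexp (r * -t)) μ
    rw [hμ, integrable_withDensity_iff hmeas (by simp)]
    have h := integrableOn_rpow_mul_exp_neg_mul_rpow (s := s - 1) (p := 1) (b := r)
      (by linarith) one_pos hr
    refine h.congr_fun (fun t ht => ?_) measurableSet_Ioi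
    simp only [hpos t ht, Real.rpow_one]
    ring_nf
  have hreal : ∀ r : ℝ, 0 < r → ProbabilityTheory.complexMGF (fun t : ℝ => -t) μ r =
      (r : ℂ) ^ (-s : ℂ) * Real.Gamma s := by
    intro r hr
    have h := Real.integral_rpow_mul_exp_neg_mul_Ioi hs hr
    rw [one_div, Real.inv_rpow hr.le, ← Real.rpow_neg hr.le] at h
    rw [hF, ← Complex.ofReal_neg, ← Complex.ofReal_cpow hr.le, ← Complex.ofReal_mul, ← h,
      ← integral_complex_ofReal]
    simp
  have hconv : Convex ℝ {ζ : ℂ | 0 < ζ.re} := convex_halfSpace_re_gt 0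
  have hopen : IsOpen {ζ : ℂ | 0 < ζ.re} := isOpen_lt continuous_const Complex.continuous_re
  have hEq : Set.EqOn (ProbabilityTheory.complexMGF (fun t : ℝ => -t) μ)
      (fun ζ : ℂ => ζ ^ (-s : ℂ) * Real.Gamma s) {ζ : ℂ | 0 < ζ.re} := by
    refine AnalyticOnNhd.eqOn_of_preconnected_of_frequently_eq (z₀ := 1)
      (fun ζ hζ => ProbabilityTheory.analyticAt_complexMGF (hset hζ))
      (DifferentiableOn.analyticOnNhd ?_ hopen) hconv.isPreconnected (by simp) ?_
    · intro ζ hζ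
      have : ζ ∈ Complex.slitPlane := Or.inl hζ
      exact ((differentiableAt_id.cpow_const (by simpa using this)).mul_const
        _).differentiableWithinAt
    · have hev : ∀ᶠ r : ℝ in nhdsWithin 1 {1}ᶜ,
          ProbabilityTheory.complexMGF (fun t : ℝ => -t) μ r =
            (r : ℂ) ^ (-s : ℂ) * Real.Gamma s :=
        ((lt_mem_nhds one_pos).filter_mono nhdsWithin_le_nhds).mono fun r hr => hreal r hr
      have ht : Filter.Tendsto (fun r : ℝ => (r : ℂ)) (nhdsWithin 1 {1}ᶜ) (nhdsWithin 1 {1}ᶜ) := by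
        refine tendsto_nhdsWithin_iff.2 ⟨?_, ?_⟩
        · exact (Complex.continuous_ofReal.tendsto' 1 1 (by simp)).mono_left nhdsWithin_le_nhds
        · filter_upwards [self_mem_nhdsWithin] with r hr
          simpa using hr
      exact ht.frequently hev.frequently
  rw [← hF]
  exact hEq hz

section
variable {V : Type*} [NormedAddCommGroup V] [InnerProductSpace ℝ V] [FiniteDimensional ℝ V]
  [MeasurableSpace V] [BorelSpace V]

/-- The integral of a negative complex power of a quadratic polynomial with imaginary linear
part. -/
lemma integral_one_add_mul_norm_sq_sub_inner_cpow {a s : ℝ} (ha : 0 < a)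
    (hs : (Module.finrank ℝ V : ℝ) / 2 < s) (c : ℝ) {v : V} (hv : ‖v‖ = 1) :
    ∫ u : V, (1 + (a : ℂ) * (‖u‖ : ℂ) ^ 2 - 2 * Complex.I * a * c * ((⟪v, u⟫ : ℝ) : ℂ)) ^ (-s : ℂ) =
      (((π / a) ^ ((Module.finrank ℝ V : ℝ) / 2) * Real.Gamma (s - (Module.finrank ℝ V : ℝ) / 2) /
        Real.Gamma s * (1 + a * c ^ 2) ^ ((Module.finrank ℝ V : ℝ) / 2 - s) : ℝ) : ℂ) := by
  set n : ℝ := (Module.finrank ℝ V : ℝ) / 2 with hn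
  have hn0 : 0 ≤ n := by positivity
  have hs0 : 0 < s := hn0.trans_lt hs
  have hG : (Real.Gamma s : ℂ) ≠ 0 := by exact_mod_cast (Real.Gamma_pos_of_pos hs0).ne'
  set Q : V → ℂ := fun u =>
    1 + (a : ℂ) * (‖u‖ : ℂ) ^ 2 - 2 * Complex.I * a * c * ((⟪v, u⟫ : ℝ) : ℂ) with hQ
  have hQre : ∀ u, (Q u).re = 1 + a * ‖u‖ ^ 2 := by
    intro u
    have h : Q u = ((1 + a * ‖u‖ ^ 2 : ℝ) : ℂ) + ((-(2 * a * c * ⟪v, u⟫) : ℝ) : ℂ) * Complex.I := by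
      simp only [hQ]; push_cast; ring
    rw [h]; simp [-Complex.ofReal_add, -Complex.ofReal_mul, -Complex.ofReal_neg]
  set F : V → ℝ → ℂ := fun u t => ((t ^ (s - 1) : ℝ) : ℂ) * Complex.exp (-(Q u * t)) with hF
  have hFac : ∀ u t, F u t = (((t ^ (s - 1) * rexp (-t) : ℝ) : ℂ)) *
      Complex.exp (-((t * a : ℝ) : ℂ) * ‖u‖ ^ 2 + (2 * Complex.I * a * c * t) * ((⟪v, u⟫ : ℝ) : ℂ)) := by
    intro u t
    simp only [hF, hQ, Complex.ofReal_mul, Complex.ofReal_exp, mul_assoc, ← Complex.exp_add]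
    congr 2
    push_cast
    ring
  have hgauss : ∀ t : ℝ, 0 < t → ∫ u, F u t =
      (((π / a) ^ n * (t ^ (s - n - 1) * rexp (-((1 + a * c ^ 2) * t))) : ℝ) : ℂ) := by
    intro t ht
    have hta : 0 < t * a := mul_pos ht ha
    have hta' : (t : ℂ) * a ≠ 0 := by exact_mod_cast hta.ne'
    simp_rw [hFac]
    rw [integral_const_mul, GaussianFourier.integral_cexp_neg_mul_sq_norm_add (by simpa using hta),
      hv]
    have e1 : ((π : ℂ) / ((t * a : ℝ) : ℂ)) ^ ((Module.finrank ℝ V : ℂ) / 2) =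
        (((π / a) ^ n * t ^ (-n) : ℝ) : ℂ) := by
      rw [show π / a = (π / (t * a)) * t by field_simp,
        Real.mul_rpow (by positivity) ht.le, mul_assoc, ← Real.rpow_add ht, add_neg_cancel,
        Real.rpow_zero, mul_one, Complex.ofReal_cpow (by positivity), hn]
      push_cast
      rfl
    have e2 : Complex.exp ((2 * Complex.I * a * c * t) ^ 2 * ((1 : ℝ) : ℂ) ^ 2 /
        (4 * ((t * a : ℝ) : ℂ))) = ((rexp (-(a * c ^ 2 * t)) : ℝ) : ℂ) := by
      rw [Complex.ofReal_exp]
      congr 1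
      push_cast
      rw [div_eq_iff (by simpa using hta')]
      linear_combination (4 * (a : ℂ) ^ 2 * c ^ 2 * t ^ 2) * Complex.I_sq
    rw [e1, e2, ← Complex.ofReal_mul, ← Complex.ofReal_mul]
    congr 1
    rw [show s - n - 1 = (s - 1) + -n by ring, Real.rpow_add ht,
      show -((1 + a * c ^ 2) * t) = -t + -(a * c ^ 2 * t) by ring, Real.exp_add]
    ring
  have hnorm : ∀ t : ℝ, 0 < t → ∫ u, ‖F u t‖ =
      (π / a) ^ n * (t ^ (s - n - 1) * rexp (-t)) := by
    intro t ht
    have hta : 0 < t * a := mul_pos ht ha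
    have h1 : ∀ u, ‖F u t‖ = (t ^ (s - 1) * rexp (-t)) * rexp (-(t * a) * ‖u‖ ^ 2) := by
      intro u
      simp only [hF]
      rw [norm_mul, Complex.norm_exp, Complex.norm_real, Real.norm_of_nonneg (by positivity),
        mul_assoc, ← Real.exp_add]
      congr 2
      simp [hQre u]
      ring
    simp_rw [h1]
    rw [integral_const_mul, GaussianFourier.integral_rexp_neg_mul_sq_norm hta, ← hn,
      show π / a = (π / (t * a)) * t by field_simp,
      Real.mul_rpow (by positivity) ht.le, show s - 1 = n + (s - n - 1) by ring,
      Real.rpow_add ht]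
    ring
  have hInt : Integrable (Function.uncurry F) (volume.prod (volume.restrict (Set.Ioi 0))) := by
    have hm : AEStronglyMeasurable (Function.uncurry F)
        (volume.prod (volume.restrict (Set.Ioi 0))) := by
      apply Measurable.aestronglyMeasurable
      simp only [hF, hQ, Function.uncurry_def]
      fun_prop
    rw [integrable_prod_iff' hm]
    constructor
    · refine (ae_restrict_iff' measurableSet_Ioi).2 (.of_forall fun t ht => ?_)
      simp only [Function.uncurry_apply_pair, hFac]
      exact (GaussianFourier.integrable_cexp_neg_mul_sq_norm_add
        (by simpa using mul_pos (Set.mem_Ioi.1 ht) ha) _ _).const_mul _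
    · have h := (Real.GammaIntegral_convergent (sub_pos.2 hs)).const_mul ((π / a) ^ n)
      refine IntegrableOn.congr_fun h (fun t ht => ?_) measurableSet_Ioi
      simp only [Function.uncurry_apply_pair, hnorm t ht]
      ring
  have hK : 0 < 1 + a * c ^ 2 := by positivity
  have key : (∫ u, Q u ^ (-s : ℂ)) * Real.Gamma s =
      (((π / a) ^ n * ((1 + a * c ^ 2) ^ (n - s) * Real.Gamma (s - n)) : ℝ) : ℂ) := by
    calc (∫ u, Q u ^ (-s : ℂ)) * Real.Gamma s = ∫ u, ∫ t in Set.Ioi 0, F u t := by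
          rw [← integral_mul_const]
          refine integral_congr_ae (.of_forall fun u => ?_)
          have hu : 0 < (Q u).re := by rw [hQre]; positivity
          exact (integral_rpow_mul_cexp_neg_mul_Ioi_s5 hs0 hu).symm
      _ = ∫ t in Set.Ioi 0, ∫ u, F u t := integral_integral_swap hInt
      _ = ∫ t in Set.Ioi (0 : ℝ),
          (((π / a) ^ n * (t ^ (s - n - 1) * rexp (-((1 + a * c ^ 2) * t))) : ℝ) : ℂ) :=
          setIntegral_congr_fun measurableSet_Ioi fun t ht => hgauss t ht
      _ = _ := by
          rw [integral_complex_ofReal, integral_const_mul,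
            Real.integral_rpow_mul_exp_neg_mul_Ioi (sub_pos.2 hs) hK, one_div,
            Real.inv_rpow hK.le, ← Real.rpow_neg hK.le, neg_sub]
  rw [eq_div_of_mul_eq hG key, ← Complex.ofReal_div]
  congr 1
  ring

end

/-- closed form of the deformed exponential `Exp_ϑ` for `η = λ = 1`:
for `1 < q < (d+4)/(d+2)`, `w ≥ 0` and any unit vector `v`,
`π_{qd}^{-d/2} ∫ exp_q(-‖u‖²) [1 - 2i√w(q-1)(v·u)/(1+(q-1)‖u‖²)]^{1/(1-q)} du
  = exp_{q̃}(-[2+d(1-q)]w/2)` with `q̃ = [2+(d-2)(1-q)]/[2+d(1-q)]`;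
in particular the left-hand integral is real-valued. -/
theorem stmt5 (d : ℕ) (hd : 1 ≤ d) (q : ℝ) (hq1 : 1 < q)
    (hq2 : q < ((d : ℝ) + 4) / ((d : ℝ) + 2))
    (w : ℝ) (hw : 0 ≤ w) (v : EuclideanSpace ℝ (Fin d)) (hv : ‖v‖ = 1)
    (qt : ℝ) (hqt : qt = (2 + ((d : ℝ) - 2) * (1 - q)) / (2 + (d : ℝ) * (1 - q))) :
    ((piQd q d ^ (-(d : ℝ) / 2) : ℝ) : ℂ) *
      (∫ u : EuclideanSpace ℝ (Fin d), (qExp q (-‖u‖ ^ 2) : ℂ) *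
        (1 - 2 * Complex.I * ((Real.sqrt w : ℝ) : ℂ) * ((q : ℂ) - 1) * ((⟪v, u⟫ : ℝ) : ℂ) /
            (1 + ((q : ℂ) - 1) * ((‖u‖ ^ 2 : ℝ) : ℂ))) ^ ((1 / (1 - q) : ℂ))) =
      ((qExp qt (-((2 + (d : ℝ) * (1 - q)) * w / 2)) : ℝ) : ℂ) := by
  have hd0 : (0 : ℝ) < d := by exact_mod_cast hd
  have ha : 0 < q - 1 := sub_pos.2 hq1
  have hqd : (q - 1) * (d + 2) < 2 := by
    rw [lt_div_iff₀ (by positivity)] at hq2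
    linarith
  have hden : 0 < 2 + (d : ℝ) * (1 - q) := by nlinarith
  have hne : (1 : ℝ) - q ≠ 0 := by linarith
  set s : ℝ := 1 / (q - 1) with hs
  have hs1 : 1 / (1 - q) = -s := by
    rw [hs, ← neg_sub q 1, div_neg]
  have hs2 : (d : ℝ) / 2 < s := by
    rw [hs, div_lt_div_iff₀ two_pos ha]
    nlinarith
  have hq : ∀ x : EuclideanSpace ℝ (Fin d),
      qExp q (-‖x‖ ^ 2) = (1 + (q - 1) * ‖x‖ ^ 2) ^ (-s) := by
    intro x
    have h : 1 + (1 - q) * -‖x‖ ^ 2 = 1 + (q - 1) * ‖x‖ ^ 2 := by ring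
    rw [qExp, if_neg hq1.ne', h, if_pos (by positivity), hs1]
  have hexp : (1 / (1 - q) : ℂ) = (-s : ℂ) := by exact_mod_cast congrArg Complex.ofReal hs1
  have hfin : (Module.finrank ℝ (EuclideanSpace ℝ (Fin d)) : ℝ) = d := by simp
  have hmain := fun c : ℝ => integral_one_add_mul_norm_sq_sub_inner_cpow ha
    (by rwa [hfin]) c hv
  simp only [hfin] at hmain
  set K : ℝ := (π / (q - 1)) ^ ((d : ℝ) / 2) * Real.Gamma (s - (d : ℝ) / 2) / Real.Gamma s with hK
  have hKpos : 0 < K := by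
    have h1 := Real.Gamma_pos_of_pos (sub_pos.2 hs2)
    have h2 := Real.Gamma_pos_of_pos (lt_trans (by positivity) hs2)
    positivity
  have hnorm : ∫ x : EuclideanSpace ℝ (Fin d), qExp q (-‖x‖ ^ 2) = K := by
    have h := hmain 0
    rw [← Complex.ofReal_inj, ← integral_complex_ofReal]
    simp only [Complex.ofReal_zero, mul_zero, zero_mul, sub_zero, ne_eq, OfNat.ofNat_ne_zero,
      not_false_eq_true, zero_pow, add_zero, Real.one_rpow, mul_one] at h
    rw [← h]
    refine integral_congr_ae (.of_forall fun x => ?_)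
    simp only [hq]
    rw [Complex.ofReal_cpow (by positivity)]
    push_cast
    rfl
  have hpi : piQd q d ^ (-(d : ℝ) / 2) = K⁻¹ := by
    rw [piQd, hnorm, ← Real.rpow_mul hKpos.le,
      show 2 / (d : ℝ) * (-(d : ℝ) / 2) = -1 by field_simp, Real.rpow_neg_one]
  have hInt : (∫ u : EuclideanSpace ℝ (Fin d), (qExp q (-‖u‖ ^ 2) : ℂ) *
        (1 - 2 * Complex.I * ((Real.sqrt w : ℝ) : ℂ) * ((q : ℂ) - 1) * ((⟪v, u⟫ : ℝ) : ℂ) /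
            (1 + ((q : ℂ) - 1) * ((‖u‖ ^ 2 : ℝ) : ℂ))) ^ ((1 / (1 - q) : ℂ))) =
      ((K * (1 + (q - 1) * w) ^ ((d : ℝ) / 2 - s) : ℝ) : ℂ) := by
    have h := hmain (√w)
    rw [Real.sq_sqrt hw] at h
    rw [← h]
    refine integral_congr_ae (.of_forall fun u => ?_)
    have hr : 0 < 1 + (q - 1) * ‖u‖ ^ 2 := by positivity
    have hr' : (1 + ((q : ℂ) - 1) * (‖u‖ : ℂ) ^ 2) ≠ 0 := by exact_mod_cast hr.ne'
    have hz : 1 - 2 * Complex.I * ((√w : ℝ) : ℂ) * ((q : ℂ) - 1) * ((⟪v, u⟫ : ℝ) : ℂ) /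
        (1 + ((q : ℂ) - 1) * ((‖u‖ ^ 2 : ℝ) : ℂ)) ≠ 0 := by
      intro h0
      have h1 : 1 - 2 * Complex.I * ((√w : ℝ) : ℂ) * ((q : ℂ) - 1) * ((⟪v, u⟫ : ℝ) : ℂ) /
          (1 + ((q : ℂ) - 1) * ((‖u‖ ^ 2 : ℝ) : ℂ)) = ((1 : ℝ) : ℂ) +
          ((-(2 * √w * (q - 1) * ⟪v, u⟫ / (1 + (q - 1) * ‖u‖ ^ 2)) : ℝ) : ℂ) * Complex.I := by
        push_cast
        ring
      rw [h1] at h0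
      have h2 := congrArg Complex.re h0
      rw [Complex.add_re, Complex.re_ofReal_mul] at h2
      simp at h2
    have hmul : ∀ z : ℂ, z ≠ 0 → ((1 + (q - 1) * ‖u‖ ^ 2 : ℝ) : ℂ) ^ (-s : ℂ) * z ^ (-s : ℂ) =
        (((1 + (q - 1) * ‖u‖ ^ 2 : ℝ) : ℂ) * z) ^ (-s : ℂ) := by
      intro z hz
      rw [Complex.cpow_def_of_ne_zero (by exact_mod_cast hr.ne'), Complex.cpow_def_of_ne_zero hz,
        Complex.cpow_def_of_ne_zero (mul_ne_zero (by exact_mod_cast hr.ne') hz),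
        Complex.log_ofReal_mul hr hz, ← Complex.exp_add, Complex.ofReal_log hr.le, add_mul]
    simp only [hq, hexp]
    rw [Complex.ofReal_cpow hr.le, Complex.ofReal_neg, hmul _ hz]
    congr 1
    push_cast
    field_simp
  have h1qt : 1 - qt = 2 * (1 - q) / (2 + d * (1 - q)) := by
    rw [hqt]
    field_simp
    ring
  have hqt1 : qt ≠ 1 := by
    intro h
    rw [h, sub_self, eq_comm, div_eq_zero_iff] at h1qt
    rcases h1qt with h | h
    · exact hne (by linarith)
    · exact hden.ne' h
  have harg : 1 + (1 - qt) * (-((2 + (d : ℝ) * (1 - q)) * w / 2)) = 1 + (q - 1) * w := by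
    have h := (eq_div_iff hden.ne').1 h1qt
    linear_combination (-w / 2) * h
  have hqte : 1 / (1 - qt) = (d : ℝ) / 2 - s := by
    rw [h1qt, hs, ← neg_sub 1 q]
    field_simp
    ring
  rw [hpi, hInt, qExp, if_neg hqt1, harg, if_pos (by positivity), hqte, ← Complex.ofReal_mul,
    inv_mul_cancel_left₀ hKpos.ne']
end

section
/- Non-invertibility of the q-Fourier transform (Hilhorst's example): let 1 < q < 2 and r ≥ 0, and let H_{r;q} be the Hilhorst density. Then for every k ∈ ℝ, ∫_{{H_{r;q}>0}} H_{r;q}(x) · exp_q(i k x H_{r;q}(x)^{q-1}) dx = ∫_ℝ G_q(x;0,1) · exp_q(i k x G_q(x;0,1)^{q-1}) dx; that is, all members of the family {H_{r;q}}_{r≥0} share the same q-Fourier transform as the q-Gaussian G_q(·;0,1), so the q-Fourier transform is not injective on probability densities. -/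
open MeasureTheory Real

/-- `π_{q1} = (∫_ℝ exp_q(-x²) dx)²`. -/
noncomputable def piQ1 (q : ℝ) : ℝ := (∫ x : ℝ, qExp q (-x ^ 2)) ^ 2

/-- `2_{q1} = π_{q1}^{1/2} / ∫_ℝ x² exp_q(-x²) dx`. -/
noncomputable def twoQ1 (q : ℝ) : ℝ := Real.sqrt (piQ1 q) / ∫ x : ℝ, x ^ 2 * qExp q (-x ^ 2)

/-- The one-dimensional q-Gaussian `G_q(x;0,1)`. -/
noncomputable def Gq1 (q : ℝ) (x : ℝ) : ℝ :=
  qExp q (-(x ^ 2 / twoQ1 q)) / Real.sqrt (twoQ1 q * piQ1 q)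

/-- The Hilhorst density `H_{r;q}`. -/
noncomputable def Hil (q r : ℝ) (x : ℝ) : ℝ :=
  if x ≠ 0 ∧ r < |x| ^ ((q - 2) / (q - 1)) then
    (|x| ^ ((q - 2) / (q - 1)) - r) ^ (1 / (q - 2)) /
        (Real.sqrt (twoQ1 q * piQ1 q) * |x| ^ (1 / (q - 1))) *
      qExp q (-((|x| ^ ((q - 2) / (q - 1)) - r) ^ (2 * (q - 1) / (q - 2)) / twoQ1 q))
  else 0

/-- The odd change of variables `x ↦ sign x * (|x| ^ b - r) ^ (1 / b)`. -/
noncomputable def oddShift (b r x : ℝ) : ℝ :=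
  if 0 < x then (|x| ^ b - r) ^ (1 / b) else -(|x| ^ b - r) ^ (1 / b)

lemma abs_oddShift {b r x : ℝ} (h : r < |x| ^ b) :
    |oddShift b r x| = (|x| ^ b - r) ^ (1 / b) := by
  have hp : 0 < (|x| ^ b - r) ^ (1 / b) := rpow_pos_of_pos (sub_pos.2 h) _
  unfold oddShift
  split_ifs
  · exact abs_of_pos hp
  · rw [abs_neg, abs_of_pos hp]

lemma oddShift_ne_zero {b r x : ℝ} (h : r < |x| ^ b) : oddShift b r x ≠ 0 := by
  rw [← abs_pos, abs_oddShift h]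
  exact rpow_pos_of_pos (sub_pos.2 h) _

lemma oddShift_pos_iff {b r x : ℝ} (h : r < |x| ^ b) : 0 < oddShift b r x ↔ 0 < x := by
  have hp : 0 < (|x| ^ b - r) ^ (1 / b) := rpow_pos_of_pos (sub_pos.2 h) _
  unfold oddShift
  split_ifs with hx
  · exact iff_of_true hp hx
  · exact iff_of_false (by linarith) hx

lemma abs_oddShift_rpow {b r x : ℝ} (hb : b ≠ 0) (h : r < |x| ^ b) :
    |oddShift b r x| ^ b = |x| ^ b - r := by
  rw [abs_oddShift h, ← rpow_mul (sub_pos.2 h).le, one_div_mul_cancel hb, rpow_one]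

lemma oddShift_neg_oddShift {b r x : ℝ} (hb : b ≠ 0) (h : r < |x| ^ b) :
    oddShift b (-r) (oddShift b r x) = x := by
  rw [oddShift, abs_oddShift_rpow hb h, sub_neg_eq_add, sub_add_cancel,
    ← rpow_mul (abs_nonneg x), mul_one_div_cancel hb, rpow_one]
  simp only [oddShift_pos_iff h]
  split_ifs with hx'
  · exact abs_of_pos hx'
  · rw [abs_of_nonpos (not_lt.1 hx'), neg_neg]

lemma oddShift_eq_self_mul {b r x : ℝ} (hx : x ≠ 0) (h : r < |x| ^ b) :
    oddShift b r x = x * (|oddShift b r x| / |x|) := by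
  have hx0 : |x| ≠ 0 := abs_ne_zero.2 hx
  rcases lt_or_gt_of_ne hx with hx' | hx'
  · have : oddShift b r x ≤ 0 := not_lt.1 fun h' => hx'.not_gt ((oddShift_pos_iff h).1 h')
    rw [abs_of_nonpos this, abs_of_neg hx']
    field_simp
  · have : 0 < oddShift b r x := (oddShift_pos_iff h).2 hx'
    rw [abs_of_pos this, abs_of_pos hx']
    field_simp

lemma hasDerivAt_oddShift {b r x : ℝ} (hb : b ≠ 0) (hx : x ≠ 0) (h : r < |x| ^ b) :
    HasDerivAt (oddShift b r) ((|oddShift b r x| / |x|) ^ (1 - b)) x := by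
  have key : ∀ y : ℝ, 0 < y → r < y ^ b →
      HasDerivAt (fun t : ℝ => (t ^ b - r) ^ (1 / b)) (((y ^ b - r) ^ (1 / b) / y) ^ (1 - b)) y := by
    intro y hy hry
    have hs := sub_pos.2 hry
    have h1 := ((hasDerivAt_rpow_const (p := b) (Or.inl hy.ne')).sub_const r).rpow_const
      (p := 1 / b) (Or.inl hs.ne')
    convert h1 using 1
    rw [div_rpow (rpow_nonneg hs.le _) hy.le, ← rpow_mul hs.le, div_eq_mul_inv, ← rpow_neg hy.le,
      neg_sub, show 1 / b * (1 - b) = 1 / b - 1 by field_simp]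
    field_simp
  rw [abs_oddShift h]
  rcases lt_or_gt_of_ne hx with hx' | hx'
  · rw [abs_of_neg hx'] at h ⊢
    have h2 := ((key (-x) (neg_pos.2 hx') h).comp x (hasDerivAt_neg x)).neg
    simp only [mul_neg, mul_one, neg_neg] at h2
    refine h2.congr_of_eventuallyEq ?_
    filter_upwards [gt_mem_nhds hx'] with t ht
    simp [oddShift, not_lt.2 ht.le, abs_of_neg ht]
  · rw [abs_of_pos hx'] at h ⊢
    refine (key x hx' h).congr_of_eventuallyEq ?_
    filter_upwards [lt_mem_nhds hx'] with t ht
    simp [oddShift, ht, abs_of_pos ht]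

lemma oddShift_image {b r : ℝ} (hb : b ≠ 0) (hr : 0 ≤ r) :
    oddShift b r '' {x | x ≠ 0 ∧ r < |x| ^ b} = {0}ᶜ := by
  ext y
  constructor
  · rintro ⟨x, ⟨-, h⟩, rfl⟩
    exact oddShift_ne_zero h
  · intro hy
    have hy0 : 0 < |y| ^ b := rpow_pos_of_pos (abs_pos.2 hy) _
    have hy' : -r < |y| ^ b := by linarith
    refine ⟨oddShift b (-r) y, ⟨oddShift_ne_zero hy', ?_⟩, ?_⟩
    · rw [abs_oddShift_rpow hb hy']
      linarith
    · simpa using oddShift_neg_oddShift hb hy'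

lemma measurableSet_oddShift_domain (b r : ℝ) :
    MeasurableSet {x : ℝ | x ≠ 0 ∧ r < |x| ^ b} := by
  have hf : Measurable fun x : ℝ => |x| ^ b := by fun_prop
  exact (measurableSet_singleton (0 : ℝ)).compl.inter (measurableSet_lt measurable_const hf)

lemma setIntegral_oddShift {E : Type*} [NormedAddCommGroup E] [NormedSpace ℝ E] {b r : ℝ}
    (hb : b ≠ 0) (hr : 0 ≤ r) (g : ℝ → E) :
    ∫ x in {x : ℝ | x ≠ 0 ∧ r < |x| ^ b},
      ((|oddShift b r x| / |x|) ^ (1 - b)) • g (oddShift b r x) = ∫ y, g y := by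
  have hS := measurableSet_oddShift_domain b r
  have h := integral_image_eq_integral_abs_deriv_smul hS
    (fun x hx => (hasDerivAt_oddShift hb hx.1 hx.2).hasDerivWithinAt)
    (fun x hx y hy hxy => by
      rw [← oddShift_neg_oddShift hb hx.2, hxy, oddShift_neg_oddShift hb hy.2]) g
  rw [oddShift_image hb hr, restrict_compl_singleton] at h
  rw [h]
  refine setIntegral_congr_fun hS fun x _ => ?_
  rw [abs_of_nonneg (by positivity : (0 : ℝ) ≤ (|oddShift b r x| / |x|) ^ (1 - b))]

lemma qExp_neg_pos {q u : ℝ} (hq : 1 < q) (hu : 0 ≤ u) : 0 < qExp q (-u) := by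
  have h : 0 < 1 + (1 - q) * -u := by nlinarith
  rw [qExp, if_neg hq.ne', if_pos h]
  exact rpow_pos_of_pos h _

lemma qExp_nonneg (q u : ℝ) : 0 ≤ qExp q u := by
  unfold qExp
  split_ifs with _ h
  · exact (Real.exp_pos u).le
  · exact rpow_nonneg h.le _
  · exact le_rfl

lemma twoQ1_nonneg (q : ℝ) : 0 ≤ twoQ1 q :=
  div_nonneg (Real.sqrt_nonneg _)
    (integral_nonneg fun x => mul_nonneg (sq_nonneg x) (qExp_nonneg q _))

lemma Gq1_nonneg (q x : ℝ) : 0 ≤ Gq1 q x := div_nonneg (qExp_nonneg _ _) (Real.sqrt_nonneg _)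

lemma Hil_eq_mul_Gq1 {q r x : ℝ} (hq1 : 1 < q) (hq2 : q < 2) (hx : x ≠ 0)
    (h : r < |x| ^ ((q - 2) / (q - 1))) :
    Hil q r x = (|oddShift ((q - 2) / (q - 1)) r x| / |x|) ^ (1 / (q - 1)) *
      Gq1 q (oddShift ((q - 2) / (q - 1)) r x) := by
  have hs := (sub_pos.2 h).le
  have hq1' : q - 1 ≠ 0 := by linarith
  have hq2' : q - 2 ≠ 0 := by linarith
  rw [Hil, if_pos ⟨hx, h⟩, Gq1, ← sq_abs (oddShift _ r x), abs_oddShift h,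
    div_rpow (rpow_nonneg hs _) (abs_nonneg x), ← rpow_mul hs,
    ← rpow_natCast ((|x| ^ ((q - 2) / (q - 1)) - r) ^ (1 / ((q - 2) / (q - 1)))), ← rpow_mul hs,
    show 1 / ((q - 2) / (q - 1)) * (1 / (q - 1)) = 1 / (q - 2) by field_simp,
    show 1 / ((q - 2) / (q - 1)) * ((2 : ℕ) : ℝ) = 2 * (q - 1) / (q - 2) by
      push_cast; field_simp]
  rw [div_mul_div_comm, div_mul_eq_mul_div, mul_comm (|x| ^ _)]

lemma mul_Hil_rpow {q r x : ℝ} (hq1 : 1 < q) (hq2 : q < 2) (hx : x ≠ 0)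
    (h : r < |x| ^ ((q - 2) / (q - 1))) :
    x * Hil q r x ^ (q - 1) = oddShift ((q - 2) / (q - 1)) r x *
      Gq1 q (oddShift ((q - 2) / (q - 1)) r x) ^ (q - 1) := by
  have hD : 0 ≤ |oddShift ((q - 2) / (q - 1)) r x| / |x| := by positivity
  have hq1' : q - 1 ≠ 0 := by linarith
  rw [Hil_eq_mul_Gq1 hq1 hq2 hx h, mul_rpow (rpow_nonneg hD _) (Gq1_nonneg _ _), ← rpow_mul hD,
    one_div_mul_cancel hq1', rpow_one, ← mul_assoc, ← oddShift_eq_self_mul hx h]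

lemma setOf_Hil_pos {q r : ℝ} (hq1 : 1 < q) (hC : 0 < √(twoQ1 q * piQ1 q)) :
    {x : ℝ | 0 < Hil q r x} = {x : ℝ | x ≠ 0 ∧ r < |x| ^ ((q - 2) / (q - 1))} := by
  ext x
  constructor
  · intro hx
    by_contra hn
    simp only [Set.mem_ofPred_eq] at hx hn
    rw [Hil, if_neg hn] at hx
    exact lt_irrefl _ hx
  · rintro ⟨hx, h⟩
    have hs := sub_pos.2 h
    have hx0 := abs_pos.2 hx
    have hE : 0 < qExp q
        (-((|x| ^ ((q - 2) / (q - 1)) - r) ^ (2 * (q - 1) / (q - 2)) / twoQ1 q)) :=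
      qExp_neg_pos hq1 (div_nonneg (rpow_nonneg hs.le _) (twoQ1_nonneg q))
    rw [Set.mem_ofPred_eq, Hil, if_pos ⟨hx, h⟩]
    positivity

/-- non-invertibility of the q-Fourier transform (Hilhorst's example):
for `1 < q < 2` and `r ≥ 0`, the q-Fourier transform of `H_{r;q}` coincides, for every `k`,
with that of the q-Gaussian `G_q(·;0,1)`. -/
theorem stmt7 (q r : ℝ) (hq1 : 1 < q) (hq2 : q < 2) (hr : 0 ≤ r) (k : ℝ) :
    (∫ x in {x : ℝ | 0 < Hil q r x}, (Hil q r x : ℂ) *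
        qExpC q (Complex.I * (k : ℂ) * (x : ℂ) * ((Hil q r x ^ (q - 1) : ℝ) : ℂ))) =
      ∫ x : ℝ, (Gq1 q x : ℂ) *
        qExpC q (Complex.I * (k : ℂ) * (x : ℂ) * ((Gq1 q x ^ (q - 1) : ℝ) : ℂ)) := by
  have hq1' : q - 1 ≠ 0 := by linarith
  have hb : (q - 2) / (q - 1) ≠ 0 := div_ne_zero (by linarith) hq1'
  rcases (Real.sqrt_nonneg (twoQ1 q * piQ1 q)).eq_or_lt with hC | hC
  · have hG : ∀ x, Gq1 q x = 0 := fun x => by rw [Gq1, ← hC, div_zero]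
    have hH : ∀ x, Hil q r x = 0 := fun x => by
      rw [Hil, ← hC]
      simp
    simp [hG, hH]
  · rw [setOf_Hil_pos hq1 hC, ← setIntegral_oddShift hb hr]
    refine setIntegral_congr_fun (measurableSet_oddShift_domain _ _) fun x hx => ?_
    have hmul := congrArg (fun t : ℝ => (t : ℂ)) (mul_Hil_rpow hq1 hq2 hx.1 hx.2)
    simp only [Complex.ofReal_mul] at hmul
    simp only [mul_assoc, hmul]
    rw [Hil_eq_mul_Gq1 hq1 hq2 hx.1 hx.2, Complex.real_smul,
      show 1 - (q - 2) / (q - 1) = 1 / (q - 1) by field_simp; ring]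
    push_cast
    ring
end

section
/- Escort-moment expansion of the ϑ-Fourier transform: let d ≥ 1 be an integer, q > 1, η, λ real, α = η + dλ(1-q), and s_n = 1 + n(1-α)/d for n = 1,2,3. Let p be a probability density on ℝ^d such that ∫_{{p>0}} ‖x‖^n p(x)^{s_n} dx < ∞ for n = 1,2,3. Then, as k → 0, F_p(k) = 1 + i k·m₁ - (q/2) kᵀ M₂ k + O(‖k‖³), where m₁ = ∫_{{p>0}} x p(x)^{s_1} dx ∈ ℝ^d and M₂ = ∫_{{p>0}} x xᵀ p(x)^{s_2} dx. -/
open MeasureTheory Real Matrix Asymptotics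
open scoped RealInnerProductSpace

/-- Integrating a power bound on the derivative from the origin. -/
lemma norm_le_of_hasDerivAt_of_norm_deriv_le_pow {f f' : ℝ → ℂ} {C : ℝ} (hC : 0 ≤ C) (n : ℕ)
    (h0 : f 0 = 0) (hf : ∀ t, HasDerivAt f (f' t) t) (hb : ∀ t, ‖f' t‖ ≤ C * |t| ^ n) (t : ℝ) :
    ‖f t‖ ≤ C * |t| ^ (n + 1) := by
  have h := (convex_uIcc (0 : ℝ) t).norm_image_sub_le_of_norm_hasDerivWithin_le
    (f := f) (f' := f') (C := C * |t| ^ n) (fun x _ => (hf x).hasDerivWithinAt)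
    (fun x hx => (hb x).trans ?_) Set.left_mem_uIcc Set.right_mem_uIcc
  · simpa [h0, pow_succ, mul_assoc] using h
  · have : |x| ≤ |t| := by simpa using Set.abs_sub_left_of_mem_uIcc hx
    gcongr

lemma one_add_mul_I_mem_slitPlane (b t : ℝ) : 1 + (b : ℂ) * (Complex.I * t) ∈ Complex.slitPlane := by
  left; simp

lemma hasDerivAt_one_add_mul_I_cpow (b c t : ℝ) :
    HasDerivAt (fun t : ℝ => (1 + (b : ℂ) * (Complex.I * t)) ^ (c : ℂ))
      ((c * b * Complex.I) * (1 + (b : ℂ) * (Complex.I * t)) ^ ((c - 1 : ℝ) : ℂ)) t := by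
  have h : HasDerivAt (fun z : ℂ => 1 + (b : ℂ) * (Complex.I * z)) (b * Complex.I) t := by
    simpa using (((hasDerivAt_id (t : ℂ)).const_mul Complex.I).const_mul (b : ℂ)).const_add 1
  convert (h.cpow_const (c := (c : ℂ)) (one_add_mul_I_mem_slitPlane b t)).comp_ofReal using 1
  push_cast
  ring

lemma norm_one_add_mul_I_cpow_le_one (b t : ℝ) {c : ℝ} (hc : c ≤ 0) :
    ‖(1 + (b : ℂ) * (Complex.I * t)) ^ (c : ℂ)‖ ≤ 1 := by
  rw [Complex.norm_cpow_real]
  refine Real.rpow_le_one_of_one_le_of_nonpos ?_ hc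
  simpa using Complex.abs_re_le_norm (1 + (b : ℂ) * (Complex.I * t))

lemma qExpC_I_mul_eq {q : ℝ} (hq : 1 < q) (t : ℝ) :
    qExpC q (Complex.I * t) =
      (1 + ((1 - q : ℝ) : ℂ) * (Complex.I * t)) ^ ((1 / (1 - q) : ℝ) : ℂ) := by
  simp [qExpC, hq.ne']

lemma continuous_qExpC_I_mul {q : ℝ} (hq : 1 < q) :
    Continuous fun t : ℝ => qExpC q (Complex.I * t) := by
  simp_rw [qExpC_I_mul_eq hq]
  exact continuous_iff_continuousAt.2 fun t => (hasDerivAt_one_add_mul_I_cpow _ _ t).continuousAt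

/-- Second order Taylor expansion of the `q`-exponential along the imaginary axis, with a
globally valid cubic remainder. -/
lemma norm_qExpC_I_mul_sub_le {q : ℝ} (hq : 1 < q) (t : ℝ) :
    ‖qExpC q (Complex.I * t) - (1 + Complex.I * t - q / 2 * t ^ 2)‖
      ≤ q * (2 * q - 1) * |t| ^ 3 := by
  have hq' : (1 - q : ℝ) ≠ 0 := by linarith
  have hqC : (1 - q : ℂ) ≠ 0 := by exact_mod_cast hq'
  have hC : 0 ≤ q * (2 * q - 1) := by nlinarith
  have hc : 1 / (1 - q) < 0 := one_div_neg.2 (by linarith)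
  let φ : ℕ → ℝ → ℂ := fun n t =>
    (1 + ((1 - q : ℝ) : ℂ) * (Complex.I * t)) ^ ((1 / (1 - q) - n : ℝ) : ℂ)
  have hφ0 (n : ℕ) : φ n 0 = 1 := by simp [φ]
  have hφ (n : ℕ) (t : ℝ) :
      HasDerivAt (φ n) ((1 - n * (1 - q)) * Complex.I * φ (n + 1) t) t := by
    convert hasDerivAt_one_add_mul_I_cpow (1 - q) (1 / (1 - q) - n) t using 1
    have e : (1 / (1 - q) - (n : ℝ) - 1 : ℝ) = 1 / (1 - q) - ((n + 1 : ℕ) : ℝ) := by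
      push_cast; ring
    simp only [φ, e]
    congr 2
    push_cast
    field_simp
  have hbound (n : ℕ) (t : ℝ) : ‖φ n t‖ ≤ 1 :=
    norm_one_add_mul_I_cpow_le_one _ _ (by have : (0 : ℝ) ≤ n := n.cast_nonneg; linarith)
  have h2 (t : ℝ) : ‖-(q : ℂ) * φ 2 t + q‖ ≤ q * (2 * q - 1) * |t| ^ 1 := by
    refine norm_le_of_hasDerivAt_of_norm_deriv_le_pow hC 0 (f := fun t => -(q : ℂ) * φ 2 t + q)
      (by simp [hφ0]) (fun t => ((hφ 2 t).const_mul _).add_const _) (fun t => ?_) t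
    have e : -(q : ℂ) * ((1 - (2 : ℕ) * (1 - q)) * Complex.I * φ (2 + 1) t) =
        ((-(q * (2 * q - 1)) : ℝ) : ℂ) * (Complex.I * φ 3 t) := by push_cast; ring
    rw [e, norm_mul, norm_mul, Complex.norm_I, Complex.norm_real, norm_neg, Real.norm_of_nonneg hC]
    simpa using mul_le_mul_of_nonneg_left (hbound 3 t) hC
  have h1 (t : ℝ) : ‖Complex.I * φ 1 t - (Complex.I - q * t)‖ ≤ q * (2 * q - 1) * |t| ^ 2 := by
    refine norm_le_of_hasDerivAt_of_norm_deriv_le_pow hC 1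
      (f := fun t : ℝ => Complex.I * φ 1 t - (Complex.I - q * t))
      (f' := fun t => -(q : ℂ) * φ 2 t + q) (by simp [hφ0]) (fun t => ?_) h2 t
    refine (((hφ 1 t).const_mul Complex.I).sub
      (((hasDerivAt_id (t : ℂ)).const_mul (q : ℂ)).const_sub Complex.I).comp_ofReal).congr_deriv ?_
    push_cast
    ring_nf
    rw [Complex.I_sq]
    ring_nf
  have h0 := norm_le_of_hasDerivAt_of_norm_deriv_le_pow hC 2
      (f := fun t : ℝ => φ 0 t - (1 + Complex.I * t - q / 2 * t ^ 2))
      (f' := fun t => Complex.I * φ 1 t - (Complex.I - q * t)) (by simp [hφ0]) (fun t => ?_) h1 t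
  · simpa [φ, qExpC_I_mul_eq hq] using h0
  · refine ((hφ 0 t).sub ((((hasDerivAt_id (t : ℂ)).const_mul Complex.I).const_add 1).sub
      (((hasDerivAt_id (t : ℂ)).pow 2).const_mul ((q : ℂ) / 2))).comp_ofReal).congr_deriv ?_
    simp only [id_eq]
    push_cast
    ring

/-- Moment expansion of a `q`-deformed Fourier integral with weight `w`. -/
lemma norm_integral_qExpC_sub_le {d : ℕ} {q : ℝ} (hq : 1 < q)
    {μ : Measure (EuclideanSpace ℝ (Fin d))} {p w : EuclideanSpace ℝ (Fin d) → ℝ}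
    (hp0 : ∀ x, 0 ≤ p x) (hw0 : ∀ x, 0 ≤ w x)
    (hp : AEStronglyMeasurable p μ) (hw : AEStronglyMeasurable w μ)
    (hmom : ∀ n : ℕ, n ≤ 3 → Integrable (fun x => ‖x‖ ^ n * (p x * w x ^ n)) μ)
    (k : EuclideanSpace ℝ (Fin d)) :
    ‖∫ x, (p x : ℂ) * qExpC q (Complex.I * ((⟪k, x⟫ : ℝ) : ℂ) * (w x : ℂ)) ∂μ -
      (((∫ x, p x ∂μ : ℝ) : ℂ) + Complex.I * ((⟪k, ∫ x, (p x * w x) • x ∂μ⟫ : ℝ) : ℂ) -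
        (q : ℂ) / 2 * ((∑ i, ∑ j, k i * k j * ∫ x, x i * x j * (p x * w x ^ 2) ∂μ : ℝ) : ℂ))‖ ≤
      q * (2 * q - 1) * (∫ x, ‖x‖ ^ 3 * (p x * w x ^ 3) ∂μ) * ‖k‖ ^ 3 := by
  have hC : 0 ≤ q * (2 * q - 1) := by nlinarith
  let T : EuclideanSpace ℝ (Fin d) → ℝ := fun x => ⟪k, x⟫ * w x
  let R : EuclideanSpace ℝ (Fin d) → ℂ := fun x =>
    p x * (qExpC q (Complex.I * T x) - (1 + Complex.I * T x - q / 2 * (T x : ℂ) ^ 2))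
  have hT : AEStronglyMeasurable T μ :=
    (Continuous.aestronglyMeasurable (by fun_prop)).mul hw
  have hcont : Continuous fun t : ℝ =>
      qExpC q (Complex.I * t) - (1 + Complex.I * t - q / 2 * (t : ℂ) ^ 2) :=
    (continuous_qExpC_I_mul hq).sub (by fun_prop)
  have hRm : AEStronglyMeasurable R μ :=
    (Complex.continuous_ofReal.comp_aestronglyMeasurable hp).mul
      (hcont.comp_aestronglyMeasurable hT)
  have hRb (x) : ‖R x‖ ≤ q * (2 * q - 1) * ‖k‖ ^ 3 * (‖x‖ ^ 3 * (p x * w x ^ 3)) := by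
    have hTx : |T x| ≤ ‖k‖ * ‖x‖ * w x := by
      rw [abs_mul, abs_of_nonneg (hw0 x)]
      exact mul_le_mul_of_nonneg_right (abs_real_inner_le_norm k x) (hw0 x)
    rw [norm_mul, Complex.norm_real, Real.norm_of_nonneg (hp0 x)]
    calc _ ≤ p x * (q * (2 * q - 1) * (‖k‖ * ‖x‖ * w x) ^ 3) := by
          refine mul_le_mul_of_nonneg_left ((norm_qExpC_I_mul_sub_le hq _).trans ?_) (hp0 x)
          gcongr
      _ = _ := by ring
  have hbi : Integrable (fun x => q * (2 * q - 1) * ‖k‖ ^ 3 * (‖x‖ ^ 3 * (p x * w x ^ 3))) μ :=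
    (hmom 3 le_rfl).const_mul _
  have hRi : Integrable R μ := hbi.mono' hRm (ae_of_all _ hRb)
  have hpi : Integrable p μ := by simpa using hmom 0 (by norm_num)
  have hmi : Integrable (fun x => (p x * w x) • x) μ := by
    refine (hmom 1 (by norm_num)).mono' ((hp.mul hw).smul aestronglyMeasurable_id)
      (ae_of_all _ fun x => ?_)
    rw [norm_smul, Real.norm_of_nonneg (mul_nonneg (hp0 x) (hw0 x))]
    simp [mul_comm]
  have hM (i j : Fin d) : Integrable (fun x => x i * x j * (p x * w x ^ 2)) μ := by
    refine (hmom 2 (by norm_num)).mono'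
      ((Continuous.aestronglyMeasurable (by fun_prop)).mul (hp.mul (hw.pow 2)))
      (ae_of_all _ fun x => ?_)
    rw [norm_mul, norm_mul, Real.norm_of_nonneg (mul_nonneg (hp0 x) (pow_nonneg (hw0 x) 2)),
      sq ‖x‖]
    exact mul_le_mul_of_nonneg_right
      (mul_le_mul (PiLp.norm_apply_le x i) (PiLp.norm_apply_le x j) (norm_nonneg _)
        (norm_nonneg _)) (mul_nonneg (hp0 x) (pow_nonneg (hw0 x) 2))
  have e1 : ⟪k, ∫ x, (p x * w x) • x ∂μ⟫ = ∫ x, p x * T x ∂μ := by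
    rw [← integral_inner hmi]
    simp only [inner_smul_right, T]
    congr 1; ext x; ring
  have i1 : Integrable (fun x => p x * T x) μ := by
    refine (hmi.const_inner k).congr (ae_of_all _ fun x => ?_)
    simp only [inner_smul_right, T]; ring
  have key (x : EuclideanSpace ℝ (Fin d)) :
      ∑ i, ∑ j, k i * k j * (x i * x j * (p x * w x ^ 2)) = p x * T x ^ 2 := by
    have : ⟪k, x⟫ = ∑ i, k i * x i := by simp [PiLp.inner_apply, mul_comm]
    simp only [T, this, mul_pow, sq (∑ i, k i * x i), Finset.sum_mul_sum]
    simp only [Finset.sum_mul, Finset.mul_sum]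
    refine Finset.sum_congr rfl fun i _ => Finset.sum_congr rfl fun j _ => by ring
  have e2 : ∑ i, ∑ j, k i * k j * ∫ x, x i * x j * (p x * w x ^ 2) ∂μ =
      ∫ x, p x * T x ^ 2 ∂μ := by
    simp_rw [← key]
    rw [integral_finsetSum _ fun i _ => integrable_finsetSum _ fun j _ => (hM i j).const_mul _]
    refine Finset.sum_congr rfl fun i _ => ?_
    rw [integral_finsetSum _ fun j _ => (hM i j).const_mul _]
    simp_rw [integral_const_mul]
  have i2 : Integrable (fun x => p x * T x ^ 2) μ := by
    simp_rw [← key]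
    exact integrable_finsetSum _ fun i _ => integrable_finsetSum _ fun j _ =>
      (hM i j).const_mul _
  have split : ∫ x, (p x : ℂ) * qExpC q (Complex.I * ((⟪k, x⟫ : ℝ) : ℂ) * (w x : ℂ)) ∂μ =
      (∫ x, R x ∂μ) + (((∫ x, p x ∂μ : ℝ) : ℂ) + Complex.I * ((∫ x, p x * T x ∂μ : ℝ) : ℂ) -
        (q : ℂ) / 2 * ((∫ x, p x * T x ^ 2 ∂μ : ℝ) : ℂ)) := by
    have j0 : Integrable (fun x => (p x : ℂ)) μ := hpi.ofReal
    have j1 : Integrable (fun x => Complex.I * ((p x * T x : ℝ) : ℂ)) μ := i1.ofReal.const_mul _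
    have j2 : Integrable (fun x => (q : ℂ) / 2 * ((p x * T x ^ 2 : ℝ) : ℂ)) μ :=
      i2.ofReal.const_mul _
    have j01 : Integrable (fun x => (p x : ℂ) + Complex.I * ((p x * T x : ℝ) : ℂ)) μ := j0.add j1
    have j : Integrable (fun x => (p x : ℂ) + Complex.I * ((p x * T x : ℝ) : ℂ) -
        (q : ℂ) / 2 * ((p x * T x ^ 2 : ℝ) : ℂ)) μ := j01.sub j2
    rw [← integral_complex_ofReal, ← integral_complex_ofReal, ← integral_complex_ofReal,
      ← integral_const_mul, ← integral_const_mul, ← integral_add j0 j1,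
      ← integral_sub j01 j2, ← integral_add hRi j]
    refine integral_congr_ae (ae_of_all _ fun x => ?_)
    simp only [R, T]
    push_cast
    simp only [mul_assoc]
    ring
  rw [e1, e2, split, add_sub_cancel_right]
  refine (norm_integral_le_of_norm_le hbi (ae_of_all _ hRb)).trans_eq ?_
  rw [integral_const_mul]
  ring

/-- escort-moment expansion of the ϑ-Fourier transform: with
`s_n = 1 + n(1-α)/d` and finite escort moments up to order 3, as `k → 0`,
`F_p(k) = 1 + i k·m₁ - (q/2) kᵀM₂k + O(‖k‖³)`, where `m₁ = ∫ x p^{s₁}` and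
`M₂ = ∫ x xᵀ p^{s₂}`. -/
theorem stmt8 (d : ℕ) (hd : 1 ≤ d) (q η lam : ℝ) (hq : 1 < q)
    (α : ℝ) (hα : α = η + d * lam * (1 - q))
    (p : EuclideanSpace ℝ (Fin d) → ℝ) (hp0 : ∀ x, 0 ≤ p x) (hp1 : (∫ x, p x) = 1)
    (hmom : ∀ n : ℕ, 1 ≤ n → n ≤ 3 →
      IntegrableOn (fun x : EuclideanSpace ℝ (Fin d) =>
        ‖x‖ ^ n * p x ^ (1 + (n : ℝ) * (1 - α) / (d : ℝ))) {x | 0 < p x})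
    (m1 : EuclideanSpace ℝ (Fin d))
    (hm1 : m1 = ∫ x in {x | 0 < p x}, (p x ^ (1 + (1 - α) / (d : ℝ))) • x)
    (M2 : Matrix (Fin d) (Fin d) ℝ)
    (hM2 : ∀ i j, M2 i j =
      ∫ x in {x | 0 < p x}, x i * x j * p x ^ (1 + 2 * (1 - α) / (d : ℝ))) :
    (fun k : EuclideanSpace ℝ (Fin d) =>
        thetaFT q α d p k -
          (1 + Complex.I * ((⟪k, m1⟫ : ℝ) : ℂ) -
            ((q : ℂ) / 2) * (((k : Fin d → ℝ) ⬝ᵥ (M2 *ᵥ (k : Fin d → ℝ)) : ℝ) : ℂ)))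
      =O[nhds 0] fun k => ‖k‖ ^ 3 := by
  have hpi : Integrable p := by
    by_contra h
    simp [integral_undef h] at hp1
  have hS : NullMeasurableSet {x | 0 < p x} :=
    nullMeasurableSet_lt aemeasurable_const hpi.aemeasurable
  have hpow (c : ℝ) (n : ℕ) {x : EuclideanSpace ℝ (Fin d)} (hx : 0 < p x)
      (hc : c = 1 + n * ((1 - α) / d)) : p x ^ c = p x * (p x ^ ((1 - α) / (d : ℝ))) ^ n := by
    rw [hc, Real.rpow_add hx, Real.rpow_one, mul_comm (n : ℝ), Real.rpow_mul_natCast hx.le]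
  have hae := ae_restrict_mem₀ hS
  have hint : ∫ x in {x | 0 < p x}, p x = 1 := by
    rw [← hp1]
    exact setIntegral_eq_integral_of_forall_compl_eq_zero fun x hx =>
      le_antisymm (not_lt.1 hx) (hp0 x)
  have hm1' : m1 = ∫ x in {x | 0 < p x}, (p x * p x ^ ((1 - α) / (d : ℝ))) • x := by
    rw [hm1]
    refine integral_congr_ae (hae.mono fun x hx => ?_)
    simp only [hpow (1 + (1 - α) / d) 1 hx (by push_cast; ring), pow_one]
  have hM2' (i j : Fin d) : M2 i j =
      ∫ x in {x | 0 < p x}, x i * x j * (p x * (p x ^ ((1 - α) / (d : ℝ))) ^ 2) := by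
    rw [hM2]
    refine integral_congr_ae (hae.mono fun x hx => ?_)
    simp only [hpow (1 + 2 * (1 - α) / d) 2 hx (by push_cast; ring)]
  refine IsBigO.of_bound (q * (2 * q - 1) * ∫ x in {x | 0 < p x},
    ‖x‖ ^ 3 * (p x * (p x ^ ((1 - α) / (d : ℝ))) ^ 3)) (Filter.Eventually.of_forall fun k => ?_)
  have h := norm_integral_qExpC_sub_le hq (μ := volume.restrict {x | 0 < p x}) (p := p)
    (w := fun x => p x ^ ((1 - α) / (d : ℝ))) hp0 (fun x => Real.rpow_nonneg (hp0 x) _)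
    hpi.aestronglyMeasurable.restrict
    (hpi.aemeasurable.pow_const _).aestronglyMeasurable.restrict (fun n hn => ?_) k
  · have hquad : (k : Fin d → ℝ) ⬝ᵥ (M2 *ᵥ (k : Fin d → ℝ)) =
        ∑ i, ∑ j, k i * k j * M2 i j := by
      simp only [dotProduct, mulVec, Finset.mul_sum]
      refine Finset.sum_congr rfl fun i _ => Finset.sum_congr rfl fun j _ => by ring
    simp only [← hM2'] at h
    rw [hint, ← hm1', ← hquad, Complex.ofReal_one] at h
    rwa [Real.norm_of_nonneg (by positivity : 0 ≤ ‖k‖ ^ 3)]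
  · rcases Nat.eq_zero_or_pos n with rfl | hn0
    · simpa using hpi.restrict (s := {x | 0 < p x})
    · refine (hmom n hn0 hn).congr (hae.mono fun x hx => ?_)
      simp only [hpow (1 + n * (1 - α) / d) n hx (by ring)]
end

section
/- First-order expansion of the deformed exponential E_ϑ at the origin: let d ≥ 1 be an integer, q > 1, η > 0 with (d+2)(q-1) < 2η, λ real, α = η + dλ(1-q), s₂ = 1 + 2(1-α)/d, and assume s₂ > 0 and (d+2)(q-1) < 2η s₂. Let q' = [s₂-(1-q)]/s₂ and θ' = (q', η, d). Then, with E_ϑ as defined below, lim_{w→0⁺} (E_ϑ(w) - 1)/w = -(2q/2_{θ'}) (π_{θ'}/π_θ)^{d/2} s₂^{-(d+2)/(2η)}. -/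
open MeasureTheory Real Filter
open scoped RealInnerProductSpace

/-- `π_θ = (∫_{ℝ^d} exp_q(-‖x‖^{2η}) dx)^{2/d}`. -/
noncomputable def piTheta (q η : ℝ) (d : ℕ) : ℝ :=
  (∫ x : EuclideanSpace ℝ (Fin d), qExp q (-‖x‖ ^ (2 * η))) ^ (2 / (d : ℝ))

/-- `2_θ = d π_θ^{d/2} / ∫_{ℝ^d} ‖x‖² exp_q(-‖x‖^{2η}) dx`. -/
noncomputable def twoTheta (q η : ℝ) (d : ℕ) : ℝ :=
  d * piTheta q η d ^ ((d : ℝ) / 2) /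
    ∫ x : EuclideanSpace ℝ (Fin d), ‖x‖ ^ 2 * qExp q (-‖x‖ ^ (2 * η))

/-- The deformed exponential `E_ϑ(w)` with respect to the unit vector `v`. -/
noncomputable def Etheta (q η α : ℝ) (d : ℕ) (v : EuclideanSpace ℝ (Fin d)) (w : ℝ) : ℂ :=
  ((piTheta q η d ^ (-(d : ℝ) / 2) : ℝ) : ℂ) *
    ∫ u : EuclideanSpace ℝ (Fin d), (qExp q (-‖u‖ ^ (2 * η)) : ℂ) *
      (1 - 2 * Complex.I * ((Real.sqrt w : ℝ) : ℂ) * ((q : ℂ) - 1) *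
          ((qExp q (-‖u‖ ^ (2 * η)) ^ ((1 - α) / (d : ℝ)) : ℝ) : ℂ) *
          ((⟪v, u⟫ : ℝ) : ℂ)) ^ ((1 / (1 - q) : ℂ))

/-- A derivative bound of order `n` at the origin integrates to a bound of order `n + 1`. -/
lemma norm_le_of_norm_deriv_le_pow {h h' : ℝ → ℂ} {C : ℝ} {n : ℕ} (h0 : h 0 = 0)
    (hd : ∀ y, HasDerivAt h (h' y) y) (hb : ∀ y, ‖h' y‖ ≤ C * |y| ^ n) (y : ℝ) :
    ‖h y‖ ≤ C * |y| ^ (n + 1) := by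
  have hC : 0 ≤ C := by
    have := (norm_nonneg _).trans (hb 1)
    simpa using this
  have hs : ∀ z ∈ Metric.closedBall (0 : ℝ) |y|, ‖h' z‖ ≤ C * |y| ^ n := by
    intro z hz
    rw [mem_closedBall_zero_iff, Real.norm_eq_abs] at hz
    exact (hb z).trans (by gcongr)
  have := (convex_closedBall (0 : ℝ) |y|).norm_image_sub_le_of_norm_hasDerivWithin_le
    (fun z _ => (hd z).hasDerivWithinAt) hs
    (show (0 : ℝ) ∈ Metric.closedBall (0 : ℝ) |y| by simp)
    (show y ∈ Metric.closedBall (0 : ℝ) |y| by simp)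
  rw [h0, sub_zero, sub_zero, Real.norm_eq_abs] at this
  rwa [pow_succ, ← mul_assoc]

lemma one_sub_I_mul_mem_slitPlane (y : ℝ) : 1 - Complex.I * (y : ℂ) ∈ Complex.slitPlane := by
  left; simp

lemma hasDerivAt_one_sub_I_mul_cpow (s y : ℝ) :
    HasDerivAt (fun y : ℝ => (1 - Complex.I * (y : ℂ)) ^ (-(s : ℂ)))
      (Complex.I * s * (1 - Complex.I * (y : ℂ)) ^ (-((s + 1 : ℝ) : ℂ))) y := by
  have h1 : HasDerivAt (fun y : ℝ => 1 - Complex.I * (y : ℂ)) (-Complex.I) y := by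
    simpa using ((Complex.ofRealCLM.hasDerivAt (x := y)).const_mul Complex.I).const_sub 1
  have h2 := (hasDerivAt_id _).cpow_const (c := -(s : ℂ)) (one_sub_I_mul_mem_slitPlane y)
  refine (h2.scomp y h1).congr_deriv ?_
  rw [show -((s + 1 : ℝ) : ℂ) = -(s : ℂ) - 1 by push_cast; ring, smul_eq_mul, id]
  ring

lemma norm_one_sub_I_mul_cpow_le {s : ℝ} (hs : 0 ≤ s) (y : ℝ) :
    ‖(1 - Complex.I * (y : ℂ)) ^ (-(s : ℂ))‖ ≤ 1 := by
  have h1 : (1 : ℝ) ≤ ‖1 - Complex.I * (y : ℂ)‖ := by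
    simpa using Complex.re_le_norm (1 - Complex.I * (y : ℂ))
  rw [← Complex.ofReal_neg, Complex.norm_cpow_real]
  exact Real.rpow_le_one_of_one_le_of_nonpos h1 (by linarith)

lemma norm_cpow_sub_one_le {s : ℝ} (hs : 0 ≤ s) (y : ℝ) :
    ‖(1 - Complex.I * (y : ℂ)) ^ (-(s : ℂ)) - 1‖ ≤ s * |y| := by
  have := norm_le_of_norm_deriv_le_pow (n := 0) (C := s)
    (h := fun y : ℝ => (1 - Complex.I * (y : ℂ)) ^ (-(s : ℂ)) - 1) (by simp)
    (fun y => (hasDerivAt_one_sub_I_mul_cpow s y).sub_const 1) (fun y => by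
      have := norm_one_sub_I_mul_cpow_le (s := s + 1) (by linarith) y
      rw [norm_mul, norm_mul, Complex.norm_I, Complex.norm_real, Real.norm_of_nonneg hs]
      simpa using mul_le_mul_of_nonneg_left this hs) y
  simpa using this

lemma norm_cpow_sub_linear_le {s : ℝ} (hs : 0 ≤ s) (y : ℝ) :
    ‖(1 - Complex.I * (y : ℂ)) ^ (-(s : ℂ)) - 1 - Complex.I * s * y‖ ≤ s * (s + 1) * |y| ^ 2 := by
  refine norm_le_of_norm_deriv_le_pow (n := 1) (C := s * (s + 1))
    (h := fun y : ℝ => (1 - Complex.I * (y : ℂ)) ^ (-(s : ℂ)) - 1 - Complex.I * s * y) (by simp)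
    (fun y => ((hasDerivAt_one_sub_I_mul_cpow s y).sub_const 1).sub
      ((Complex.ofRealCLM.hasDerivAt (x := y)).const_mul (Complex.I * s))) (fun y => ?_) y
  have := norm_cpow_sub_one_le (s := s + 1) (by linarith) y
  have e : ∀ z : ℂ, Complex.I * s * z - Complex.I * s * Complex.ofRealCLM 1
      = Complex.I * s * (z - 1) := by intro z; simp; ring
  rw [e, norm_mul, norm_mul, Complex.norm_I, Complex.norm_real, Real.norm_of_nonneg hs, one_mul,
    pow_one, mul_assoc]
  exact mul_le_mul_of_nonneg_left this hs

lemma norm_cpow_sub_quadratic_le {s : ℝ} (hs : 0 ≤ s) (y : ℝ) :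
    ‖(1 - Complex.I * (y : ℂ)) ^ (-(s : ℂ)) - 1 - Complex.I * s * y + s * (s + 1) / 2 * y ^ 2‖
      ≤ s * ((s + 1) * (s + 2)) * |y| ^ 3 := by
  have hsq : ∀ y : ℝ, HasDerivAt (fun y : ℝ => (s * (s + 1) / 2 * (y : ℂ) ^ 2 : ℂ))
      (s * (s + 1) * y) y := fun y => by
    refine ((((Complex.ofRealCLM.hasDerivAt (x := y)).pow 2)).const_mul
      ((s : ℂ) * (s + 1) / 2)).congr_deriv ?_
    simp; ring
  refine norm_le_of_norm_deriv_le_pow (n := 2) (C := s * ((s + 1) * (s + 2)))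
    (h := fun y : ℝ => (1 - Complex.I * (y : ℂ)) ^ (-(s : ℂ)) - 1 - Complex.I * s * y
      + s * (s + 1) / 2 * y ^ 2) (by simp)
    (fun y => (((hasDerivAt_one_sub_I_mul_cpow s y).sub_const 1).sub
      ((Complex.ofRealCLM.hasDerivAt (x := y)).const_mul (Complex.I * s))).add (hsq y))
      (fun y => ?_) y
  have := norm_cpow_sub_linear_le (s := s + 1) (by linarith) y
  have e : ∀ z : ℂ, Complex.I * s * z - Complex.I * s * Complex.ofRealCLM 1 + s * (s + 1) * y
      = Complex.I * s * (z - 1 - Complex.I * (s + 1 : ℝ) * y) := by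
    intro z; simp
    linear_combination ((s : ℂ) * (s + 1) * y) * Complex.I_mul_I
  rw [e, norm_mul, norm_mul, Complex.norm_I, Complex.norm_real, Real.norm_of_nonneg hs, one_mul]
  refine (mul_le_mul_of_nonneg_left this hs).trans (le_of_eq ?_)
  ring

lemma tendsto_integral_mul_cpow {E : Type*} [MeasurableSpace E] {μ : Measure E} {G h : E → ℝ}
    (hG : Measurable G) (hh : Measurable h) (hG0 : ∀ u, 0 ≤ G u) (hGi : Integrable G μ)
    (hGh : Integrable (fun u => G u * h u ^ 2) μ) (hodd : ∫ u, G u * h u ∂μ = 0)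
    {s : ℝ} (hs : 0 ≤ s) :
    Tendsto (fun w : ℝ => ((∫ u, (G u : ℂ) *
        (1 - Complex.I * ((√w * h u : ℝ) : ℂ)) ^ (-(s : ℂ)) ∂μ) - ((∫ u, G u ∂μ : ℝ) : ℂ)) / (w : ℂ))
      (nhdsWithin 0 (Set.Ioi 0))
      (nhds ((-(s * (s + 1) / 2) * ∫ u, G u * h u ^ 2 ∂μ : ℝ) : ℂ)) := by
  have hGh1 : Integrable (fun u => G u * h u) μ := by
    refine (hGi.add hGh).mono' (hG.mul hh).aestronglyMeasurable (ae_of_all _ fun u => ?_)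
    have : |h u| ≤ 1 + h u ^ 2 := by
      rw [← sq_abs]; nlinarith [sq_nonneg (|h u| - 1), abs_nonneg (h u)]
    rw [Real.norm_eq_abs, abs_mul, abs_of_nonneg (hG0 u)]
    simpa [mul_add] using mul_le_mul_of_nonneg_left this (hG0 u)
  have hcm : ∀ w : ℝ, Measurable fun u =>
      (1 - Complex.I * ((√w * h u : ℝ) : ℂ)) ^ (-(s : ℂ)) := fun w => by fun_prop
  have key : ∀ w ∈ Set.Ioi (0 : ℝ), ((∫ u, (G u : ℂ) *
        (1 - Complex.I * ((√w * h u : ℝ) : ℂ)) ^ (-(s : ℂ)) ∂μ) - ((∫ u, G u ∂μ : ℝ) : ℂ)) / (w : ℂ)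
      = ∫ u, (G u : ℂ) * ((1 - Complex.I * ((√w * h u : ℝ) : ℂ)) ^ (-(s : ℂ)) - 1 -
          Complex.I * s * ((√w * h u : ℝ) : ℂ)) / w ∂μ := by
    intro w _
    have i1 : Integrable (fun u => (G u : ℂ) *
        (1 - Complex.I * ((√w * h u : ℝ) : ℂ)) ^ (-(s : ℂ))) μ := by
      refine hGi.mono' ((Complex.measurable_ofReal.comp hG).mul (hcm w)).aestronglyMeasurable
        (ae_of_all _ fun u => ?_)
      rw [norm_mul, Complex.norm_real, Real.norm_of_nonneg (hG0 u)]
      exact mul_le_of_le_one_right (hG0 u) (norm_one_sub_I_mul_cpow_le hs _)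
    have i2 : Integrable (fun u => (G u : ℂ)) μ := hGi.ofReal
    have i3 : Integrable (fun u => Complex.I * s * √w * ((G u * h u : ℝ) : ℂ)) μ :=
      hGh1.ofReal.const_mul _
    rw [integral_div]
    congr 1
    have e : ∀ u, (G u : ℂ) * ((1 - Complex.I * ((√w * h u : ℝ) : ℂ)) ^ (-(s : ℂ)) - 1 -
          Complex.I * s * ((√w * h u : ℝ) : ℂ)) = (G u : ℂ) *
        (1 - Complex.I * ((√w * h u : ℝ) : ℂ)) ^ (-(s : ℂ)) - (G u : ℂ) -
          Complex.I * s * √w * ((G u * h u : ℝ) : ℂ) := by intro u; push_cast; ring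
    simp_rw [e]
    rw [integral_sub (by exact i1.sub i2) i3, integral_sub i1 i2, integral_const_mul,
      integral_complex_ofReal, integral_complex_ofReal, hodd]
    simp
  rw [tendsto_congr' (eventually_nhdsWithin_of_forall key), ← integral_const_mul,
    ← integral_complex_ofReal]
  refine tendsto_integral_filter_of_dominated_convergence
    (fun u => s * (s + 1) * (G u * h u ^ 2)) ?_ ?_ (hGh.const_mul _) (ae_of_all _ fun u => ?_)
  · refine Eventually.of_forall fun w => Measurable.aestronglyMeasurable ?_
    have := hcm w
    fun_prop
  · refine eventually_nhdsWithin_of_forall fun w hw => ae_of_all _ fun u => ?_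
    have hw' : (0 : ℝ) < w := hw
    have := norm_cpow_sub_linear_le hs (√w * h u)
    rw [norm_div, norm_mul, Complex.norm_real, Complex.norm_real, Real.norm_of_nonneg (hG0 u),
      Real.norm_of_nonneg hw'.le, div_le_iff₀ hw']
    refine (mul_le_mul_of_nonneg_left this (hG0 u)).trans (le_of_eq ?_)
    rw [sq_abs, mul_pow, Real.sq_sqrt hw'.le]
    ring
  · rw [tendsto_iff_norm_sub_tendsto_zero]
    refine squeeze_zero' (Eventually.of_forall fun _ => norm_nonneg _)
      (g := fun w => G u * (s * ((s + 1) * (s + 2)) * |h u| ^ 3) * √w) ?_ ?_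
    · refine eventually_nhdsWithin_of_forall fun w hw => ?_
      have hw' : (0 : ℝ) < w := hw
      have hwc : (w : ℂ) ≠ 0 := by exact_mod_cast hw'.ne'
      have hsqc : ((√w : ℝ) : ℂ) ^ 2 = w := by exact_mod_cast Real.sq_sqrt hw'.le
      have := norm_cpow_sub_quadratic_le hs (√w * h u)
      have e : ∀ z : ℂ, (G u : ℂ) * z / w - ((-(s * (s + 1) / 2) * (G u * h u ^ 2) : ℝ) : ℂ)
          = (G u : ℂ) * (z + s * (s + 1) / 2 * ((√w * h u : ℝ) : ℂ) ^ 2) / w := by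
        intro z
        push_cast
        rw [mul_pow, hsqc]
        field_simp
        ring
      rw [e, norm_div, norm_mul, Complex.norm_real, Complex.norm_real,
        Real.norm_of_nonneg (hG0 u), Real.norm_of_nonneg hw'.le, div_le_iff₀ hw']
      refine (mul_le_mul_of_nonneg_left this (hG0 u)).trans (le_of_eq ?_)
      rw [abs_mul, abs_of_nonneg (Real.sqrt_nonneg w), mul_pow]
      linear_combination (G u * (s * ((s + 1) * (s + 2))) * |h u| ^ 3 * √w) *
        Real.sq_sqrt hw'.le
    · have : Tendsto (fun w : ℝ => √w) (nhdsWithin 0 (Set.Ioi 0)) (nhds 0) := by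
        simpa using (Real.continuous_sqrt.tendsto 0).mono_left nhdsWithin_le_nhds
      simpa using this.const_mul (G u * (s * ((s + 1) * (s + 2)) * |h u| ^ 3))

lemma integrable_norm_pow_mul_rpow {d k : ℕ} {c η m : ℝ} (hc : 0 < c) (hη : 0 < η) (hm : 0 ≤ m)
    (h : (d : ℝ) + k < 2 * η * m) :
    Integrable (fun x : EuclideanSpace ℝ (Fin d) =>
      ‖x‖ ^ k * (1 + c * ‖x‖ ^ (2 * η)) ^ (-m)) := by
  have hint : Integrable (fun x : EuclideanSpace ℝ (Fin d) =>
      (1 + ‖x‖) ^ (-(2 * η * m - k))) := by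
    apply integrable_one_add_norm
    simp; linarith
  set K : ℝ := 2 ^ (2 * η) * (1 + 1 / c) with hK
  have hKpos : 0 < K := by positivity
  refine (hint.const_mul (K ^ m)).mono' (Measurable.aestronglyMeasurable (by fun_prop))
    (ae_of_all _ fun x => ?_)
  set r := ‖x‖ with hr
  have hr0 : 0 ≤ r := norm_nonneg x
  have hB : 0 < 1 + c * r ^ (2 * η) := by positivity
  have h1 : (1 + r) ^ (2 * η) ≤ K * (1 + c * r ^ (2 * η)) := by
    have e : K * (1 + c * r ^ (2 * η)) =
        2 ^ (2 * η) * (1 + 1 / c + c * r ^ (2 * η) + r ^ (2 * η)) := by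
      rw [hK]; field_simp; ring
    rw [e]
    have p1 : 0 ≤ r ^ (2 * η) := by positivity
    have p2 : 0 ≤ c * r ^ (2 * η) := by positivity
    have p3 : 0 < 1 / c := by positivity
    rcases le_total r 1 with h | h
    · calc (1 + r) ^ (2 * η) ≤ 2 ^ (2 * η) := by gcongr; linarith
        _ ≤ _ := le_mul_of_one_le_right (by positivity) (by linarith)
    · calc (1 + r) ^ (2 * η) ≤ (2 * r) ^ (2 * η) := by gcongr; linarith
        _ = 2 ^ (2 * η) * r ^ (2 * η) := Real.mul_rpow (by norm_num) hr0
        _ ≤ _ := by gcongr; linarith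
  have h2 : (1 + c * r ^ (2 * η)) ^ (-m) ≤ K ^ m * (1 + r) ^ (-(2 * η * m)) := by
    have := Real.rpow_le_rpow (by positivity) h1 hm
    rw [← Real.rpow_mul (by positivity), Real.mul_rpow hKpos.le hB.le] at this
    rw [Real.rpow_neg hB.le, Real.rpow_neg (by positivity), ← div_eq_mul_inv, inv_eq_one_div,
      div_le_div_iff₀ (by positivity) (by positivity)]
    linarith
  rw [Real.norm_of_nonneg (by positivity)]
  calc r ^ k * (1 + c * r ^ (2 * η)) ^ (-m)
      ≤ (1 + r) ^ k * (K ^ m * (1 + r) ^ (-(2 * η * m))) := by gcongr; linarith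
    _ = K ^ m * (1 + r) ^ (-(2 * η * m - k)) := by
      rw [show -(2 * η * m - k) = k + -(2 * η * m) by ring, Real.rpow_add (by positivity),
        Real.rpow_natCast]
      ring

lemma integral_inner_sq_mul_radial {d : ℕ} (g : ℝ → ℝ) (hg : Measurable g)
    (hi : Integrable (fun x : EuclideanSpace ℝ (Fin d) => ‖x‖ ^ 2 * g ‖x‖))
    (v : EuclideanSpace ℝ (Fin d)) (hv : ‖v‖ = 1) :
    Integrable (fun x : EuclideanSpace ℝ (Fin d) => ⟪v, x⟫ ^ 2 * g ‖x‖) ∧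
    d * ∫ x : EuclideanSpace ℝ (Fin d), ⟪v, x⟫ ^ 2 * g ‖x‖ =
      ∫ x : EuclideanSpace ℝ (Fin d), ‖x‖ ^ 2 * g ‖x‖ := by
  have hint : ∀ v : EuclideanSpace ℝ (Fin d), ‖v‖ = 1 →
      Integrable (fun x : EuclideanSpace ℝ (Fin d) => ⟪v, x⟫ ^ 2 * g ‖x‖) := by
    intro v hv
    refine hi.mono (Measurable.aestronglyMeasurable (by fun_prop)) (ae_of_all _ fun x => ?_)
    have h1 : |⟪v, x⟫| ≤ ‖x‖ := by simpa [hv] using abs_real_inner_le_norm v x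
    rw [norm_mul, norm_mul]
    gcongr
    rw [norm_pow, norm_pow, norm_norm]
    gcongr
    exact h1
  refine ⟨hint v hv, ?_⟩
  have hrot : ∀ i, ∫ x : EuclideanSpace ℝ (Fin d), ⟪EuclideanSpace.single i (1 : ℝ), x⟫ ^ 2 * g ‖x‖
      = ∫ x : EuclideanSpace ℝ (Fin d), ⟪v, x⟫ ^ 2 * g ‖x‖ := by
    intro i
    set e : EuclideanSpace ℝ (Fin d) := EuclideanSpace.single i (1 : ℝ)
    have he : ‖v‖ = ‖e‖ := by simp [e, hv]
    set R := (ℝ ∙ (v - e))ᗮ.reflection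
    have hR : R v = e := Submodule.reflection_sub he
    rw [← (R.measurePreserving).integral_comp R.toHomeomorph.measurableEmbedding]
    simp_rw [← hR, LinearIsometryEquiv.inner_map_map, LinearIsometryEquiv.norm_map]
  have hsum : ∀ x : EuclideanSpace ℝ (Fin d), ‖x‖ ^ 2 * g ‖x‖ =
      ∑ i, ⟪EuclideanSpace.single i (1 : ℝ), x⟫ ^ 2 * g ‖x‖ := by
    intro x
    rw [← Finset.sum_mul, EuclideanSpace.norm_sq_eq]
    congr 1
    refine Finset.sum_congr rfl fun i _ => ?_
    rw [EuclideanSpace.inner_single_left]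
    simp
  simp_rw [hsum]
  rw [integral_finsetSum _ fun i _ => hint _ (by simp)]
  simp_rw [hrot]
  simp

lemma qExp_neg {q r : ℝ} (hq : 1 < q) (hr : 0 ≤ r) :
    qExp q (-r) = (1 + (q - 1) * r) ^ (-(1 / (q - 1))) := by
  have : 0 ≤ (q - 1) * r := mul_nonneg (by linarith) hr
  have e : 1 + (1 - q) * -r = 1 + (q - 1) * r := by ring
  rw [qExp, if_neg hq.ne', e, if_pos (by linarith), ← neg_sub q 1, div_neg]

lemma integral_norm_sq_mul_comp_smul {d : ℕ} (g : ℝ → ℝ) {a : ℝ} (ha : 0 < a) :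
    ∫ x : EuclideanSpace ℝ (Fin d), ‖x‖ ^ 2 * g (a * ‖x‖) =
      (a ^ (d + 2))⁻¹ * ∫ x : EuclideanSpace ℝ (Fin d), ‖x‖ ^ 2 * g ‖x‖ := by
  have := Measure.integral_comp_smul (volume : Measure (EuclideanSpace ℝ (Fin d)))
    (fun x => ‖x‖ ^ 2 * g ‖x‖) a
  simp only [norm_smul, Real.norm_of_nonneg ha.le, mul_pow, mul_assoc, integral_const_mul,
    finrank_euclideanSpace_fin, smul_eq_mul] at this
  rw [abs_of_pos (by positivity)] at this
  rw [pow_add, mul_inv, mul_right_comm, ← this, mul_comm (a ^ 2), mul_assoc,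
    mul_inv_cancel₀ (by positivity), mul_one]

lemma integral_rpow_neg_pos {d : ℕ} {c η m : ℝ} (hc : 0 < c) (hη : 0 < η) (hm : 0 ≤ m)
    (h : (d : ℝ) < 2 * η * m) :
    0 < ∫ x : EuclideanSpace ℝ (Fin d), (1 + c * ‖x‖ ^ (2 * η)) ^ (-m) := by
  have hi := integrable_norm_pow_mul_rpow (d := d) (k := 0) hc hη hm (by simpa using h)
  simp only [pow_zero, one_mul] at hi
  have hpos : ∀ x : EuclideanSpace ℝ (Fin d), 0 < (1 + c * ‖x‖ ^ (2 * η)) ^ (-m) :=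
    fun x => by positivity
  rw [integral_pos_iff_support_of_nonneg (fun x => (hpos x).le) hi]
  have : Function.support
      (fun x : EuclideanSpace ℝ (Fin d) => (1 + c * ‖x‖ ^ (2 * η)) ^ (-m)) = Set.univ :=
    Set.eq_univ_of_forall fun x => (hpos x).ne'
  rw [this]
  exact Measure.measure_univ_pos.2 (NeZero.ne _)

/-- first-order expansion of `E_ϑ` at the origin:
`lim_{w→0⁺} (E_ϑ(w) - 1)/w = -(2q/2_{θ'}) (π_{θ'}/π_θ)^{d/2} s₂^{-(d+2)/(2η)}`,
where `s₂ = 1+2(1-α)/d`, `q' = [s₂-(1-q)]/s₂` and `θ' = (q',η,d)`. -/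
theorem stmt9 (d : ℕ) (hd : 1 ≤ d) (q η lam : ℝ) (hq : 1 < q) (hη : 0 < η)
    (hcond : ((d : ℝ) + 2) * (q - 1) < 2 * η)
    (α : ℝ) (hα : α = η + d * lam * (1 - q))
    (s2 : ℝ) (hs2 : s2 = 1 + 2 * (1 - α) / (d : ℝ)) (hs2pos : 0 < s2)
    (hcond2 : ((d : ℝ) + 2) * (q - 1) < 2 * η * s2)
    (q' : ℝ) (hq' : q' = (s2 - (1 - q)) / s2)
    (v : EuclideanSpace ℝ (Fin d)) (hv : ‖v‖ = 1) :
    Tendsto (fun w : ℝ => (Etheta q η α d v w - 1) / (w : ℂ))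
      (nhdsWithin 0 (Set.Ioi 0))
      (nhds (((-(2 * q / twoTheta q' η d) * (piTheta q' η d / piTheta q η d) ^ ((d : ℝ) / 2) *
        s2 ^ (-(((d : ℝ) + 2) / (2 * η)))) : ℝ) : ℂ)) := by
  have hd0 : (0 : ℝ) < d := by exact_mod_cast hd
  have hc : 0 < q - 1 := by linarith
  set p : ℝ := 1 / (q - 1) with hp
  have hp0 : 0 < p := by positivity
  have hpc : p * (q - 1) = 1 := by rw [hp]; field_simp
  set β : ℝ := (1 - α) / d with hβ
  have hs2β : s2 = 1 + 2 * β := by rw [hs2, hβ]; ring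
  have hc1 : (d : ℝ) + 2 < 2 * η * p := by
    rw [hp, mul_one_div, lt_div_iff₀ hc]; exact hcond
  have hc2 : (d : ℝ) + 2 < 2 * η * (p * s2) := by
    have : 2 * η * (p * s2) = 2 * η * s2 / (q - 1) := by rw [hp]; ring
    rw [this, lt_div_iff₀ hc]; exact hcond2
  have hqq : q' - 1 = (q - 1) / s2 := by rw [hq']; field_simp; ring
  have hc' : 0 < q' - 1 := by rw [hqq]; positivity
  have hq1' : 1 < q' := by linarith
  have hp' : 1 / (q' - 1) = p * s2 := by rw [hqq, hp]; field_simp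
  have hr : ∀ x : EuclideanSpace ℝ (Fin d), 0 ≤ ‖x‖ ^ (2 * η) := fun x => by positivity
  have hqe : ∀ x : EuclideanSpace ℝ (Fin d), qExp q (-‖x‖ ^ (2 * η)) =
      (1 + (q - 1) * ‖x‖ ^ (2 * η)) ^ (-p) := fun x => qExp_neg hq (hr x)
  have hqe' : ∀ x : EuclideanSpace ℝ (Fin d), qExp q' (-‖x‖ ^ (2 * η)) =
      (1 + (q' - 1) * ‖x‖ ^ (2 * η)) ^ (-(p * s2)) := fun x => by
    rw [qExp_neg hq1' (hr x), hp']
  set G : EuclideanSpace ℝ (Fin d) → ℝ := fun x => (1 + (q - 1) * ‖x‖ ^ (2 * η)) ^ (-p) with hG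
  have hGpos : ∀ x, 0 < G x := fun x => by simp only [hG]; positivity
  have hGm : Measurable G := by simp only [hG]; fun_prop
  set h : EuclideanSpace ℝ (Fin d) → ℝ := fun u => 2 * (q - 1) * G u ^ β * ⟪v, u⟫ with hh
  have hhm : Measurable h := by simp only [hh]; fun_prop
  have hGi : Integrable G := by
    simpa using integrable_norm_pow_mul_rpow (d := d) (k := 0) hc hη hp0.le
      (by push_cast; linarith)
  set Z : ℝ := ∫ x, G x with hZ
  have hZpos : 0 < Z := integral_rpow_neg_pos hc hη hp0.le (by linarith)
  set Z' : ℝ := ∫ x : EuclideanSpace ℝ (Fin d),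
    (1 + (q' - 1) * ‖x‖ ^ (2 * η)) ^ (-(p * s2)) with hZ'
  have hZ'pos : 0 < Z' := integral_rpow_neg_pos hc' hη (by positivity) (by linarith)
  obtain ⟨hvi, hvint⟩ := integral_inner_sq_mul_radial
    (fun r => (1 + (q - 1) * r ^ (2 * η)) ^ (-(p * s2))) (by fun_prop)
    (integrable_norm_pow_mul_rpow (d := d) (k := 2) hc hη (by positivity) (by push_cast; exact hc2))
    v hv
  have hGh : ∀ u, G u * h u ^ 2 = (2 * (q - 1)) ^ 2 *
      (⟪v, u⟫ ^ 2 * (1 + (q - 1) * ‖u‖ ^ (2 * η)) ^ (-(p * s2))) := by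
    intro u
    have hB : 0 < 1 + (q - 1) * ‖u‖ ^ (2 * η) := by positivity
    have : (1 + (q - 1) * ‖u‖ ^ (2 * η)) ^ (-(p * s2)) = G u * (G u ^ β) ^ 2 := by
      rw [← Real.rpow_natCast (G u ^ β), ← Real.rpow_mul (hGpos u).le]
      nth_rewrite 1 [← Real.rpow_one (G u)]
      rw [← Real.rpow_add (hGpos u)]
      simp only [hG]
      rw [← Real.rpow_mul hB.le, hs2β]
      congr 1; push_cast; ring
    rw [this, hh]; ring
  have hodd : ∫ u, G u * h u = 0 := by
    have h1 := integral_neg_eq_self (fun u => G u * h u) volume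
    have h2 : ∀ u, G (-u) * h (-u) = -(G u * h u) := by
      intro u
      simp only [hh, hG, norm_neg, inner_neg_right]; ring
    simp_rw [h2] at h1
    rw [integral_neg] at h1
    linarith
  have main := tendsto_integral_mul_cpow hGm hhm (fun u => (hGpos u).le) hGi
    (by simp_rw [hGh]; exact hvi.const_mul _) hodd hp0.le
  have hpi : piTheta q η d = Z ^ (2 / (d : ℝ)) := by simp only [piTheta, hqe, hZ, hG]
  have hpi' : piTheta q' η d = Z' ^ (2 / (d : ℝ)) := by simp only [piTheta, hqe', hZ']
  have hroot : ∀ {t : ℝ}, 0 < t → (t ^ (2 / (d : ℝ))) ^ ((d : ℝ) / 2) = t := by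
    intro t ht
    rw [← Real.rpow_mul ht.le, show 2 / (d : ℝ) * (d / 2) = 1 by field_simp, Real.rpow_one]
  have hE : ∀ w : ℝ, Etheta q η α d v w = ((Z⁻¹ : ℝ) : ℂ) * ∫ u, (G u : ℂ) *
      (1 - Complex.I * ((√w * h u : ℝ) : ℂ)) ^ (-(p : ℂ)) := by
    intro w
    have e1 : piTheta q η d ^ (-(d : ℝ) / 2) = Z⁻¹ := by
      rw [neg_div, Real.rpow_neg (hpi ▸ Real.rpow_nonneg hZpos.le _), hpi, hroot hZpos]
    have e2 : (1 / (1 - q) : ℂ) = -(p : ℂ) := by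
      rw [hp, ← neg_sub (q : ℂ) 1]; push_cast; rw [div_neg]
    rw [Etheta, e1, e2]
    congr 2 with u
    rw [hqe]
    congr 3
    simp only [hh, hG, hβ]; push_cast; ring
  have hlim := main.const_mul ((Z⁻¹ : ℝ) : ℂ)
  have hfun : ∀ w : ℝ, (Etheta q η α d v w - 1) / (w : ℂ) = ((Z⁻¹ : ℝ) : ℂ) *
      (((∫ u, (G u : ℂ) * (1 - Complex.I * ((√w * h u : ℝ) : ℂ)) ^ (-(p : ℂ))) - (Z : ℂ)) /
        (w : ℂ)) := by
    intro w
    rw [hE, mul_div_assoc', mul_sub, ← Complex.ofReal_mul, inv_mul_cancel₀ hZpos.ne',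
      Complex.ofReal_one]
  simp_rw [hfun]
  convert hlim using 2
  rw [← Complex.ofReal_mul]
  congr 1
  simp_rw [hGh]
  rw [integral_const_mul]
  set I2 : ℝ := ∫ x : EuclideanSpace ℝ (Fin d), ‖x‖ ^ 2 * qExp q' (-‖x‖ ^ (2 * η)) with hI2
  have ha : 0 < s2 ^ (1 / (2 * η)) := by positivity
  have hscale := integral_norm_sq_mul_comp_smul (d := d)
    (fun r => (1 + (q' - 1) * r ^ (2 * η)) ^ (-(p * s2))) ha
  have hin : ∀ x : EuclideanSpace ℝ (Fin d), (q' - 1) * (s2 ^ (1 / (2 * η)) * ‖x‖) ^ (2 * η) =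
      (q - 1) * ‖x‖ ^ (2 * η) := by
    intro x
    rw [Real.mul_rpow ha.le (norm_nonneg x), ← Real.rpow_mul hs2pos.le,
      show 1 / (2 * η) * (2 * η) = 1 by field_simp, Real.rpow_one, hqq]
    field_simp
  have hpow : ((s2 ^ (1 / (2 * η))) ^ (d + 2))⁻¹ = s2 ^ (-(((d : ℝ) + 2) / (2 * η))) := by
    rw [← Real.rpow_natCast, ← Real.rpow_mul hs2pos.le, ← Real.rpow_neg hs2pos.le]
    congr 1; push_cast; ring
  simp_rw [hin, ← hqe'] at hscale
  rw [hpow] at hscale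
  have hval : ∫ x : EuclideanSpace ℝ (Fin d),
      ⟪v, x⟫ ^ 2 * (1 + (q - 1) * ‖x‖ ^ (2 * η)) ^ (-(p * s2)) =
      s2 ^ (-(((d : ℝ) + 2) / (2 * η))) * I2 / d := by
    rw [eq_div_iff hd0.ne', mul_comm, hvint, hscale]
  rw [hval, twoTheta, ← hI2, hpi, hpi', hroot hZ'pos,
    Real.div_rpow (Real.rpow_nonneg hZ'pos.le _) (Real.rpow_nonneg hZpos.le _), hroot hZ'pos, hroot hZpos]
  have hpq : p * (p + 1) * (q - 1) ^ 2 = q := by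
    linear_combination (p * (q - 1) + q) * hpc
  field_simp
  linear_combination I2 * hpq
end

section
/- Marginal consistency of multivariate q-Gaussians (Kolmogorov consistency condition for the generalized Wiener process): let d ≥ 1 and n ≥ 2 be integers and 1 ≤ q < (d+4)/(d+2). For an integer m ≥ 1 set q̂_m = [2q - (m-d)(1-q)] / [2 - (m-d)(1-q)] (so q̂ depends on the dimension; for m = nd this is [2q - d(n-1)(1-q)]/[2 - d(n-1)(1-q)]). Let N = nd, M = (n-1)d, and let Λ be a symmetric positive-definite N×N real matrix with top-left M×M block Λ₁₁. Then for every x ∈ ℝ^M, ∫_{ℝ^d} G_{q̂_N}^{(N)}((x,z); Λ) dz = G_{q̂_M}^{(M)}(x; Λ₁₁), where G_Q^{(m)}(y;Λ) denotes the m-dimensional Q-Gaussian density with covariance Λ. -/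
open MeasureTheory Real Matrix

/-- `π_{Qm} = (∫_{ℝ^m} exp_Q(-‖x‖²) dx)^{2/m}`. -/
noncomputable def piQm (Q : ℝ) (m : ℕ) : ℝ :=
  (∫ x : EuclideanSpace ℝ (Fin m), qExp Q (-‖x‖ ^ 2)) ^ (2 / (m : ℝ))

/-- `2_{Qm} = m π_{Qm}^{m/2} / ∫_{ℝ^m} ‖x‖² exp_Q(-‖x‖²) dx`. -/
noncomputable def twoQm (Q : ℝ) (m : ℕ) : ℝ :=
  m * piQm Q m ^ ((m : ℝ) / 2) /
    ∫ x : EuclideanSpace ℝ (Fin m), ‖x‖ ^ 2 * qExp Q (-‖x‖ ^ 2)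

/-- The `m`-dimensional centered `Q`-Gaussian with covariance matrix `Λ`:
`G_Q^{(m)}(y;Λ) = exp_Q(-yᵀΛ⁻¹y/2_{Qm}) / √((2_{Qm}π_{Qm})^m det Λ)`. -/
noncomputable def GQm (Q : ℝ) (m : ℕ) (Λ : Matrix (Fin m) (Fin m) ℝ) (y : Fin m → ℝ) : ℝ :=
  qExp Q (-((y ⬝ᵥ (Λ⁻¹ *ᵥ y)) / twoQm Q m)) /
    Real.sqrt ((twoQm Q m * piQm Q m) ^ m * Λ.det)

/-- `q̂_m = [2q - (m-d)(1-q)]/[2 - (m-d)(1-q)]`. -/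
noncomputable def qhat (q : ℝ) (d m : ℕ) : ℝ :=
  (2 * q - ((m : ℝ) - (d : ℝ)) * (1 - q)) / (2 - ((m : ℝ) - (d : ℝ)) * (1 - q))

/-- Change of variables in the integral of a function of a positive definite quadratic form. -/
theorem Matrix.PosDef.integral_comp_quadraticForm {d : ℕ} {D : Matrix (Fin d) (Fin d) ℝ}
    (hD : D.PosDef) (g : ℝ → ℝ) :
    ∫ z : Fin d → ℝ, g (z ⬝ᵥ (D *ᵥ z)) =
      (√D.det)⁻¹ * ∫ z : EuclideanSpace ℝ (Fin d), g (‖z‖ ^ 2) := by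
  obtain ⟨R, rfl⟩ : ∃ R : Matrix (Fin d) (Fin d) ℝ, D = Rᵀ * R := by
    open scoped MatrixOrder in
    obtain ⟨R, hR⟩ := CStarAlgebra.nonneg_iff_eq_star_mul_self.mp hD.posSemidef.nonneg
    exact ⟨R, by simpa [star_eq_conjTranspose] using hR⟩
  have hdet : (Rᵀ * R).det = R.det ^ 2 := by rw [det_mul, det_transpose, sq]
  have hR : R.det ≠ 0 := by
    have := hD.det_pos
    rw [hdet] at this
    exact fun h => by simp [h] at this
  have hnorm (z : Fin d → ℝ) : z ⬝ᵥ ((Rᵀ * R) *ᵥ z) = toLin' R z ⬝ᵥ toLin' R z := by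
    rw [toLin'_apply, ← mulVec_mulVec, dotProduct_mulVec, vecMul_transpose]
  have hemb : MeasurableEmbedding (toLin' R) :=
    (LinearMap.continuous_of_finiteDimensional _).measurableEmbedding <|
      mulVec_injective_of_isUnit ((isUnit_iff_isUnit_det R).mpr hR.isUnit)
  simp_rw [hnorm]
  rw [← hemb.integral_map (fun w : Fin d → ℝ => g (w ⬝ᵥ w)),
    Real.map_matrix_volume_pi_eq_smul_volume_pi hR, integral_smul_measure, hdet, Real.sqrt_sq_eq_abs,
    ← (PiLp.volume_preserving_ofLp (Fin d)).integral_comp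
      (MeasurableEquiv.toLp 2 (Fin d → ℝ)).symm.measurableEmbedding]
  simp_rw [EuclideanSpace.real_norm_sq_eq]
  simp [dotProduct, sq, abs_inv]

/-- Completing the square in the last block of variables. -/
theorem Matrix.PosDef.exists_append_dotProduct_inv {M d : ℕ}
    {Λ : Matrix (Fin (M + d)) (Fin (M + d)) ℝ} (hΛ : Λ.PosDef) :
    ∃ (D : Matrix (Fin d) (Fin d) ℝ) (L : Matrix (Fin d) (Fin M) ℝ), D.PosDef ∧
      (Λ.submatrix (Fin.castAdd d) (Fin.castAdd d)).det = Λ.det * D.det ∧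
      ∀ (x : Fin M → ℝ) (z : Fin d → ℝ),
        Fin.append x z ⬝ᵥ (Λ⁻¹ *ᵥ Fin.append x z) =
          x ⬝ᵥ ((Λ.submatrix (Fin.castAdd d) (Fin.castAdd d))⁻¹ *ᵥ x) +
            (z + L *ᵥ x) ⬝ᵥ (D *ᵥ (z + L *ᵥ x)) := by
  set Λ₁₁ := Λ.submatrix (Fin.castAdd d) (Fin.castAdd d)
  let e : Fin M ⊕ Fin d ≃ Fin (M + d) := finSumFinEquiv
  set Q : Matrix (Fin M ⊕ Fin d) (Fin M ⊕ Fin d) ℝ := Λ⁻¹.submatrix e e with hQdef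
  have hQ : Q.PosDef := hΛ.inv.submatrix e.injective
  have hPQ : Λ.submatrix e e * Q = 1 := by
    rw [hQdef, submatrix_mul_equiv, mul_nonsing_inv _ hΛ.det_pos.ne'.isUnit, submatrix_one_equiv]
  set A := Q.toBlocks₁₁
  set B := Q.toBlocks₁₂
  set D := Q.toBlocks₂₂
  have hD : D.PosDef := hQ.submatrix Sum.inr_injective
  have hC : Q.toBlocks₂₁ = Bᴴ := by
    ext i j
    exact (hQ.isHermitian.apply (Sum.inr i) (Sum.inl j)).symm
  have hQb : fromBlocks A B Bᴴ D = Q := by rw [← hC]; exact fromBlocks_toBlocks Q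
  let _ : Invertible D := D.invertibleOfIsUnitDet hD.det_pos.ne'.isUnit
  have hP : Λ.submatrix e e = fromBlocks Λ₁₁ (Λ.submatrix e e).toBlocks₁₂
      (Λ.submatrix e e).toBlocks₂₁ (Λ.submatrix e e).toBlocks₂₂ := by
    conv_lhs => rw [← fromBlocks_toBlocks (Λ.submatrix e e)]
    rfl
  set E := (Λ.submatrix e e).toBlocks₁₂
  have hS : Λ₁₁ * (A - B * D⁻¹ * Bᴴ) = 1 := by
    rw [hP, ← hQb, fromBlocks_multiply, ← fromBlocks_one, fromBlocks_inj] at hPQ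
    obtain ⟨h1, h2, -, -⟩ := hPQ
    have h3 : E = -(Λ₁₁ * B * D⁻¹) := by
      have : E * D * D⁻¹ = E := mul_nonsing_inv_cancel_right _ _ hD.det_pos.ne'.isUnit
      rw [← this, eq_neg_of_add_eq_zero_right h2, Matrix.neg_mul]
    rw [← h1, h3, Matrix.mul_sub, sub_eq_add_neg, Matrix.neg_mul]
    simp only [Matrix.mul_assoc]
  have hSinv : Λ₁₁⁻¹ = A - B * D⁻¹ * Bᴴ := inv_eq_right_inv hS
  refine ⟨D, D⁻¹ * Bᴴ, hD, ?_, fun x z => ?_⟩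
  · have h1 : Q.det = D.det * (A - B * D⁻¹ * Bᴴ).det := by
      rw [← hQb, det_fromBlocks₂₂, invOf_eq_nonsing_inv]
    have h2 := congrArg det hPQ
    have h3 := congrArg det hS
    rw [det_mul, det_submatrix_equiv_self, det_one, h1] at h2
    rw [det_mul, det_one] at h3
    have h4 : (A - B * D⁻¹ * Bᴴ).det ≠ 0 := right_ne_zero_of_mul_eq_one h3
    apply mul_right_cancel₀ h4
    rw [h3, mul_assoc, h2]
  · have h1 : Fin.append x z ⬝ᵥ (Λ⁻¹ *ᵥ Fin.append x z) =
        (x ⊕ᵥ z) ᵥ* Q ⬝ᵥ (x ⊕ᵥ z) := by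
      have hxz : (x ⊕ᵥ z) = Fin.append x z ∘ e := by
        ext (i | i) <;> simp [e]
      rw [← dotProduct_mulVec, hxz, hQdef, submatrix_mulVec_equiv, Function.comp_assoc,
        Equiv.self_comp_symm, Function.comp_id]
      exact (e.sum_comp fun i => Fin.append x z i * (Λ⁻¹ *ᵥ Fin.append x z) i).symm
    have h2 := schur_complement_eq₂₂ A B x z hD.isHermitian
    rw [hQb] at h2
    simp only [star_trivial] at h2
    rw [h1, h2, hSinv, ← dotProduct_mulVec, ← dotProduct_mulVec, add_comm, add_comm z]

/-- `2_{Qm}` is the ratio of `m` times the mass of the radial `Q`-exponential to its second moment. -/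
theorem twoQm_eq {Q a : ℝ} {m : ℕ} (hm : m ≠ 0)
    (hpos : 0 < ∫ x : EuclideanSpace ℝ (Fin m), qExp Q (-‖x‖ ^ 2))
    (h : m * ∫ x : EuclideanSpace ℝ (Fin m), qExp Q (-‖x‖ ^ 2) =
      a * ∫ x : EuclideanSpace ℝ (Fin m), ‖x‖ ^ 2 * qExp Q (-‖x‖ ^ 2)) :
    twoQm Q m = a := by
  have hm' : (m : ℝ) ≠ 0 := Nat.cast_ne_zero.mpr hm
  have hpi : piQm Q m ^ ((m : ℝ) / 2) = ∫ x : EuclideanSpace ℝ (Fin m), qExp Q (-‖x‖ ^ 2) := by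
    rw [piQm, ← Real.rpow_mul hpos.le, div_mul_div_cancel₀' two_ne_zero, div_self hm',
      Real.rpow_one]
  have hne : a * ∫ x : EuclideanSpace ℝ (Fin m), ‖x‖ ^ 2 * qExp Q (-‖x‖ ^ 2) ≠ 0 := by
    rw [← h]; positivity
  rw [twoQm, hpi, h, mul_div_cancel_right₀ _ (right_ne_zero_of_mul hne)]

/-- The normalization of the `Q`-Gaussian as the integral of its radial profile. -/
theorem GQm_eq {Q : ℝ} {m : ℕ} (hm : m ≠ 0) (h2 : 0 < twoQm Q m)
    (hpos : 0 < ∫ x : EuclideanSpace ℝ (Fin m), qExp Q (-‖x‖ ^ 2))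
    (Λ : Matrix (Fin m) (Fin m) ℝ) (y : Fin m → ℝ) :
    GQm Q m Λ y = qExp Q (-((y ⬝ᵥ (Λ⁻¹ *ᵥ y)) / twoQm Q m)) /
      ((∫ x : EuclideanSpace ℝ (Fin m), qExp Q (-(‖x‖ ^ 2 / twoQm Q m))) * √Λ.det) := by
  have hm' : (m : ℝ) ≠ 0 := Nat.cast_ne_zero.mpr hm
  set t := twoQm Q m
  have hscale : ∫ x : EuclideanSpace ℝ (Fin m), qExp Q (-(‖x‖ ^ 2 / t)) =
      √t ^ m * ∫ x : EuclideanSpace ℝ (Fin m), qExp Q (-‖x‖ ^ 2) := by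
    have h := Measure.integral_comp_inv_smul_of_nonneg (volume : Measure (EuclideanSpace ℝ (Fin m)))
      (fun x => qExp Q (-‖x‖ ^ 2)) (Real.sqrt_nonneg t)
    rw [finrank_euclideanSpace_fin, smul_eq_mul] at h
    rw [← h]
    congr with x
    rw [norm_smul, mul_pow, norm_inv, inv_pow, Real.norm_eq_abs, sq_abs, Real.sq_sqrt h2.le,
      div_eq_inv_mul]
  have hpi : piQm Q m ^ m = (∫ x : EuclideanSpace ℝ (Fin m), qExp Q (-‖x‖ ^ 2)) ^ 2 := by
    rw [piQm, ← Real.rpow_natCast, ← Real.rpow_mul hpos.le, div_mul_cancel₀ _ hm']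
    norm_num
  have hsq : (t * piQm Q m) ^ m =
      (∫ x : EuclideanSpace ℝ (Fin m), qExp Q (-(‖x‖ ^ 2 / t))) ^ 2 := by
    rw [hscale, mul_pow, hpi, mul_pow, ← pow_mul, mul_comm m, pow_mul, Real.sq_sqrt h2.le]
  rw [GQm, hsq, Real.sqrt_mul (sq_nonneg _), Real.sqrt_sq]
  rw [hscale]; positivity

/-- Splitting a radial integral over the first `M` and the last `d` coordinates. -/
theorem integral_norm_sq_add {M d : ℕ} {f : ℝ → ℝ}
    (hf : Integrable fun y : EuclideanSpace ℝ (Fin (M + d)) => f (‖y‖ ^ 2)) :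
    ∫ y : EuclideanSpace ℝ (Fin (M + d)), f (‖y‖ ^ 2) =
      ∫ x : EuclideanSpace ℝ (Fin M), ∫ z : EuclideanSpace ℝ (Fin d), f (‖x‖ ^ 2 + ‖z‖ ^ 2) := by
  let e := (MeasurableEquiv.toLp 2 (Fin M → ℝ)).symm.prodCongr
    (MeasurableEquiv.toLp 2 (Fin d → ℝ)).symm |>.trans <|
    (MeasurableEquiv.sumPiEquivProdPi (fun _ : Fin M ⊕ Fin d => ℝ)).symm |>.trans <|
    (MeasurableEquiv.piCongrLeft (fun _ => ℝ) (finSumFinEquiv (m := M) (n := d))).trans <|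
    (MeasurableEquiv.toLp 2 (Fin (M + d) → ℝ))
  have he : MeasurePreserving e volume volume :=
    (PiLp.volume_preserving_toLp (Fin (M + d))).comp <|
    (volume_measurePreserving_piCongrLeft (fun _ => ℝ) (finSumFinEquiv (m := M) (n := d))).comp <|
    (volume_measurePreserving_sumPiEquivProdPi_symm (fun _ : Fin M ⊕ Fin d => ℝ)).comp <|
    (PiLp.volume_preserving_ofLp (Fin M)).prod (PiLp.volume_preserving_ofLp (Fin d))
  have hn (p : EuclideanSpace ℝ (Fin M) × EuclideanSpace ℝ (Fin d)) :
      ‖e p‖ ^ 2 = ‖p.1‖ ^ 2 + ‖p.2‖ ^ 2 := by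
    have h (i : Fin M ⊕ Fin d) : e p (finSumFinEquiv i) = Sum.elim p.1 p.2 i := by
      have := MeasurableEquiv.piCongrLeft_apply_apply (β := fun _ => ℝ)
        (finSumFinEquiv (m := M) (n := d)) (Sum.elim p.1 p.2) i
      rw [← this]
      rcases i with i | i <;> rfl
    simp_rw [EuclideanSpace.real_norm_sq_eq]
    rw [← finSumFinEquiv.sum_comp, Fintype.sum_sum_type]
    simp_rw [h]
    simp
  have hint := (he.integrable_comp_emb e.measurableEmbedding).mpr hf
  rw [← he.integral_comp e.measurableEmbedding]
  simp only [Function.comp_def, hn] at hint ⊢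
  exact integral_prod _ hint

open Filter Topology Set in
/-- Integration by parts for the second moment of a radial function `h`, where `-r h` is the derivative of `G`. -/
theorem integral_norm_sq_mul_of_hasDerivAt {m : ℕ} (hm : m ≠ 0) {G h : ℝ → ℝ}
    (hG : ∀ r, HasDerivAt G (-(r * h r)) r)
    (hint : Integrable fun x : EuclideanSpace ℝ (Fin m) => G ‖x‖)
    (hint2 : Integrable fun x : EuclideanSpace ℝ (Fin m) => ‖x‖ ^ 2 * h ‖x‖)
    (hlim : Tendsto (fun r => r ^ m * G r) atTop (𝓝 0)) :
    ∫ x : EuclideanSpace ℝ (Fin m), ‖x‖ ^ 2 * h ‖x‖ =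
      m * ∫ x : EuclideanSpace ℝ (Fin m), G ‖x‖ := by
  obtain ⟨k, rfl⟩ := Nat.exists_eq_succ_of_ne_zero hm
  have h1 := (integrable_fun_norm_addHaar (volume : Measure (EuclideanSpace ℝ (Fin (k + 1))))
    (f := G)).mp hint
  have h2 := (integrable_fun_norm_addHaar (volume : Measure (EuclideanSpace ℝ (Fin (k + 1))))
    (f := fun r => r ^ 2 * h r)).mp hint2
  rw [integral_fun_norm_addHaar volume G, integral_fun_norm_addHaar volume fun r => r ^ 2 * h r]
  simp only [finrank_euclideanSpace_fin, Nat.succ_eq_add_one, Nat.add_sub_cancel, smul_eq_mul,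
    nsmul_eq_mul] at h1 h2 ⊢
  have hderiv (r : ℝ) : HasDerivAt (fun r => r ^ (k + 1) * G r)
      ((k + 1 : ℕ) * (r ^ k * G r) - r ^ k * (r ^ 2 * h r)) r := by
    refine ((hasDerivAt_pow (k + 1) r).fun_mul (hG r)).congr_deriv ?_
    simp only [Nat.add_sub_cancel]
    ring
  have key := integral_Ioi_of_hasDerivAt_of_tendsto' (a := 0) (fun r _ => hderiv r)
    ((h1.const_mul _).sub h2) hlim
  rw [integral_sub (h1.const_mul _) h2, integral_const_mul] at key
  simp only [zero_pow (Nat.succ_ne_zero k), zero_mul, sub_zero] at key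
  rw [← sub_eq_zero.mp key]
  ring

theorem integrable_one_add_norm_sq_div_rpow_neg {m : ℕ} {a p : ℝ} (ha : 0 < a) (hp : m < 2 * p) :
    Integrable fun x : EuclideanSpace ℝ (Fin m) => (1 + ‖x‖ ^ 2 / a) ^ (-p) := by
  have h := (integrable_rpow_neg_one_add_norm_sq (E := EuclideanSpace ℝ (Fin m))
    (μ := volume) (r := 2 * p) (by simpa using hp)).comp_smul (R := (√a)⁻¹) (by positivity)
  convert h using 3 with x
  · rw [norm_smul, mul_pow, norm_inv, inv_pow, Real.norm_eq_abs, sq_abs, Real.sq_sqrt ha.le,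
      div_eq_inv_mul]
  · ring

theorem integrable_exp_neg_norm_sq_div {m : ℕ} {a : ℝ} (ha : 0 < a) :
    Integrable fun x : EuclideanSpace ℝ (Fin m) => Real.exp (-(‖x‖ ^ 2 / a)) := by
  have h := GaussianFourier.integrable_cexp_neg_mul_sq_norm_add
    (b := ((a⁻¹ : ℝ) : ℂ)) (by simpa using ha) 0 (0 : EuclideanSpace ℝ (Fin m))
  convert h.norm using 2 with x
  rw [Complex.norm_exp]
  simp [← Complex.ofReal_pow, div_eq_inv_mul, -Complex.ofReal_inv]

theorem qExp_one_add_inv {p u : ℝ} (hp : 0 < p) (hu : 0 ≤ u) :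
    qExp (1 + p⁻¹) (-u) = (1 + u / p) ^ (-p) := by
  have h : 1 + (1 - (1 + p⁻¹)) * -u = 1 + u / p := by ring
  have h2 : (1 : ℝ) / (1 - (1 + p⁻¹)) = -p := by field_simp; ring
  rw [qExp, h, h2, if_neg (by simpa using hp.ne'), if_pos (by positivity)]

theorem qExp_one (u : ℝ) : qExp 1 u = Real.exp u := if_pos rfl

theorem integral_norm_sq_pos_of_integrable {m : ℕ} {f : ℝ → ℝ}
    (hf : Continuous fun x : EuclideanSpace ℝ (Fin m) => f (‖x‖ ^ 2))
    (hint : Integrable fun x : EuclideanSpace ℝ (Fin m) => f (‖x‖ ^ 2))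
    (hpos : ∀ u, 0 ≤ u → 0 < f u) :
    0 < ∫ x : EuclideanSpace ℝ (Fin m), f (‖x‖ ^ 2) :=
  integral_pos_of_integrable_nonneg_nonzero (x := 0) hf hint
    (fun _ => (hpos _ (sq_nonneg _)).le) (hpos _ (sq_nonneg _)).ne'

open Filter Topology in
theorem integral_qExp_pos_and_twoQm_one_add_inv {m : ℕ} (hm : m ≠ 0) {p : ℝ}
    (hp : (m : ℝ) / 2 + 1 < p) :
    0 < (∫ x : EuclideanSpace ℝ (Fin m), qExp (1 + p⁻¹) (-‖x‖ ^ 2)) ∧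
      twoQm (1 + p⁻¹) m = (2 * (p - 1) - m) / p := by
  have hm0 : (0 : ℝ) ≤ m := m.cast_nonneg
  have hp0 : 0 < p := by linarith
  have hbase (r : ℝ) : 0 < 1 + r ^ 2 / p := by positivity
  have hA : Integrable fun x : EuclideanSpace ℝ (Fin m) => (1 + ‖x‖ ^ 2 / p) ^ (-p) :=
    integrable_one_add_norm_sq_div_rpow_neg hp0 (by linarith)
  have hG : Integrable fun x : EuclideanSpace ℝ (Fin m) => (1 + ‖x‖ ^ 2 / p) ^ (-(p - 1)) :=
    integrable_one_add_norm_sq_div_rpow_neg hp0 (by linarith)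
  have hGf (r : ℝ) : (1 + r ^ 2 / p) ^ (-(p - 1)) =
      (1 + r ^ 2 / p) ^ (-p) + p⁻¹ * (r ^ 2 * (1 + r ^ 2 / p) ^ (-p)) := by
    rw [neg_sub, sub_eq_add_neg, Real.rpow_add (hbase r), Real.rpow_one]
    ring
  have hB : Integrable fun x : EuclideanSpace ℝ (Fin m) =>
      ‖x‖ ^ 2 * (1 + ‖x‖ ^ 2 / p) ^ (-p) := by
    refine ((hG.sub hA).const_mul p).congr (.of_forall fun x => ?_)
    simp only [Pi.sub_apply, hGf]
    field_simp
    ring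
  have hderiv (r : ℝ) : HasDerivAt (fun r => (1 + r ^ 2 / p) ^ (-(p - 1)))
      (-(r * (2 * (p - 1) / p * (1 + r ^ 2 / p) ^ (-p)))) r := by
    convert (((hasDerivAt_pow 2 r).div_const p).const_add 1).rpow_const
      (p := -(p - 1)) (Or.inl (hbase r).ne') using 1
    rw [show -(p - 1) - 1 = -p by ring]
    push_cast
    ring
  have hlim : Tendsto (fun r : ℝ => r ^ m * (1 + r ^ 2 / p) ^ (-(p - 1))) atTop (𝓝 0) := by
    have h := (tendsto_rpow_neg_atTop (y := 2 * (p - 1) - m) (by linarith)).const_mul (p ^ (p - 1))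
    rw [mul_zero] at h
    refine squeeze_zero' ?_ ?_ h
    · filter_upwards [eventually_ge_atTop 0] with r hr
      have := hbase r
      positivity
    · filter_upwards [eventually_gt_atTop 0] with r hr
      calc r ^ m * (1 + r ^ 2 / p) ^ (-(p - 1)) ≤ r ^ m * (r ^ 2 / p) ^ (-(p - 1)) := by
            gcongr ?_ * ?_
            exact Real.rpow_le_rpow_of_nonpos (by positivity) (by linarith) (by linarith)
        _ = p ^ (p - 1) * r ^ (-(2 * (p - 1) - m)) := by
            rw [Real.div_rpow (by positivity) hp0.le, ← Real.rpow_natCast r 2,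
              ← Real.rpow_mul hr.le, ← Real.rpow_natCast r m, Real.rpow_neg hp0.le, div_inv_eq_mul,
              ← mul_assoc, ← Real.rpow_add hr, mul_comm]
            congr 2
            push_cast
            ring
  have key := integral_norm_sq_mul_of_hasDerivAt hm hderiv hG
    ((hB.const_mul (2 * (p - 1) / p)).congr (.of_forall fun x => by ring)) hlim
  have hq (x : EuclideanSpace ℝ (Fin m)) : qExp (1 + p⁻¹) (-‖x‖ ^ 2) =
      (1 + ‖x‖ ^ 2 / p) ^ (-p) := qExp_one_add_inv hp0 (sq_nonneg _)
  have hpos : 0 < ∫ x : EuclideanSpace ℝ (Fin m), qExp (1 + p⁻¹) (-‖x‖ ^ 2) := by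
    simp_rw [hq]
    exact integral_norm_sq_pos_of_integrable (f := fun u => (1 + u / p) ^ (-p))
      (by
        refine Continuous.rpow_const (by fun_prop) fun x => Or.inl (hbase _).ne') hA
      fun u hu => by positivity
  refine ⟨hpos, twoQm_eq hm hpos ?_⟩
  simp_rw [hq]
  simp_rw [hGf, mul_left_comm _ (2 * (p - 1) / p)] at key
  rw [integral_const_mul, integral_add hA (hB.const_mul _), integral_const_mul] at key
  field_simp at key ⊢
  linarith

open Filter Topology in
theorem integral_qExp_pos_and_twoQm_one {m : ℕ} (hm : m ≠ 0) :
    0 < (∫ x : EuclideanSpace ℝ (Fin m), qExp 1 (-‖x‖ ^ 2)) ∧ twoQm 1 m = 2 := by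
  have hA : Integrable fun x : EuclideanSpace ℝ (Fin m) => Real.exp (-‖x‖ ^ 2) := by
    simpa using integrable_exp_neg_norm_sq_div (m := m) one_pos
  have hB : Integrable fun x : EuclideanSpace ℝ (Fin m) => ‖x‖ ^ 2 * Real.exp (-‖x‖ ^ 2) := by
    refine ((integrable_exp_neg_norm_sq_div (m := m) two_pos).const_mul 2).mono'
      (by fun_prop) (.of_forall fun x => ?_)
    rw [Real.norm_of_nonneg (by positivity), show -‖x‖ ^ 2 = -(‖x‖ ^ 2 / 2) + -(‖x‖ ^ 2 / 2) by ring,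
      Real.exp_add, ← mul_assoc]
    gcongr
    have h := Real.add_one_le_exp (‖x‖ ^ 2 / 2)
    rw [Real.exp_neg, ← div_eq_mul_inv, div_le_iff₀ (Real.exp_pos _)]
    linarith
  have hderiv (r : ℝ) : HasDerivAt (fun r => Real.exp (-r ^ 2))
      (-(r * (2 * Real.exp (-r ^ 2)))) r := by
    refine (hasDerivAt_pow 2 r).fun_neg.exp.congr_deriv ?_
    push_cast
    ring
  have hlim : Tendsto (fun r : ℝ => r ^ m * Real.exp (-r ^ 2)) atTop (𝓝 0) := by
    refine squeeze_zero' ?_ ?_ (Real.tendsto_pow_mul_exp_neg_atTop_nhds_zero m)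
    · filter_upwards [eventually_ge_atTop 0] with r hr
      positivity
    · filter_upwards [eventually_ge_atTop 1] with r hr
      gcongr
      nlinarith
  have key := integral_norm_sq_mul_of_hasDerivAt hm hderiv hA
    ((hB.const_mul 2).congr (.of_forall fun x => by ring)) hlim
  have hpos : 0 < ∫ x : EuclideanSpace ℝ (Fin m), qExp 1 (-‖x‖ ^ 2) := by
    simp_rw [qExp_one]
    exact integral_norm_sq_pos_of_integrable (f := fun u => Real.exp (-u)) (by fun_prop) hA
      fun u _ => Real.exp_pos _
  refine ⟨hpos, twoQm_eq hm hpos ?_⟩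
  simp_rw [qExp_one]
  rw [← key, ← integral_const_mul]
  congr with x
  ring

/-- Marginalizing an elliptical density whose radial profile `φ` integrates over `ℝ^d` to a
multiple of `ψ`. -/
theorem integral_elliptical_marginal {M d : ℕ} {φ ψ : ℝ → ℝ} {K : ℝ} (hK : K ≠ 0)
    (hφ : Integrable fun y : EuclideanSpace ℝ (Fin (M + d)) => φ (‖y‖ ^ 2))
    (hφψ : ∀ u, 0 ≤ u → ∫ z : EuclideanSpace ℝ (Fin d), φ (u + ‖z‖ ^ 2) = K * ψ u)
    {Λ : Matrix (Fin (M + d)) (Fin (M + d)) ℝ} (hΛ : Λ.PosDef) (x : Fin M → ℝ) :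
    ∫ z : EuclideanSpace ℝ (Fin d), φ (Fin.append x z ⬝ᵥ (Λ⁻¹ *ᵥ Fin.append x z)) /
        ((∫ y : EuclideanSpace ℝ (Fin (M + d)), φ (‖y‖ ^ 2)) * √Λ.det) =
      ψ (x ⬝ᵥ ((Λ.submatrix (Fin.castAdd d) (Fin.castAdd d))⁻¹ *ᵥ x)) /
        ((∫ y : EuclideanSpace ℝ (Fin M), ψ (‖y‖ ^ 2)) *
          √(Λ.submatrix (Fin.castAdd d) (Fin.castAdd d)).det) := by
  have hΛ₁₁ : (Λ.submatrix (Fin.castAdd d) (Fin.castAdd d)).PosDef :=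
    hΛ.submatrix (Fin.castAdd_injective M d)
  obtain ⟨D, L, hD, hdet, hquad⟩ := hΛ.exists_append_dotProduct_inv
  set Λ₁₁ := Λ.submatrix (Fin.castAdd d) (Fin.castAdd d)
  have hu : 0 ≤ x ⬝ᵥ (Λ₁₁⁻¹ *ᵥ x) := by
    simpa using hΛ₁₁.inv.posSemidef.dotProduct_mulVec_nonneg x
  set u := x ⬝ᵥ (Λ₁₁⁻¹ *ᵥ x)
  have hnum : ∫ z : EuclideanSpace ℝ (Fin d), φ (Fin.append x z ⬝ᵥ (Λ⁻¹ *ᵥ Fin.append x z)) =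
      (√D.det)⁻¹ * (K * ψ u) := by
    rw [(PiLp.volume_preserving_ofLp (Fin d)).integral_comp
      (MeasurableEquiv.toLp 2 (Fin d → ℝ)).symm.measurableEmbedding
      fun z => φ (Fin.append x z ⬝ᵥ (Λ⁻¹ *ᵥ Fin.append x z))]
    simp_rw [hquad]
    rw [integral_add_right_eq_self fun z => φ (u + z ⬝ᵥ (D *ᵥ z)),
      hD.integral_comp_quadraticForm fun s => φ (u + s), hφψ u hu]
  have hden : ∫ y : EuclideanSpace ℝ (Fin (M + d)), φ (‖y‖ ^ 2) =
      K * ∫ y : EuclideanSpace ℝ (Fin M), ψ (‖y‖ ^ 2) := by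
    rw [integral_norm_sq_add hφ, ← integral_const_mul]
    congr with y
    exact hφψ _ (sq_nonneg _)
  have hD0 := (Real.sqrt_pos.mpr hD.det_pos).ne'
  have hΛ0 := (Real.sqrt_pos.mpr hΛ.det_pos).ne'
  rw [integral_div, hnum, hden, hdet, Real.sqrt_mul hΛ.det_pos.le]
  field_simp

theorem integral_one_add_add_norm_sq_rpow {d : ℕ} {c r u : ℝ} (hc : 0 < c) (hu : 0 ≤ u) :
    ∫ z : EuclideanSpace ℝ (Fin d), (1 + (u + ‖z‖ ^ 2) / c) ^ (-(r + d / 2)) =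
      (∫ z : EuclideanSpace ℝ (Fin d), (1 + ‖z‖ ^ 2 / c) ^ (-(r + d / 2))) *
        (1 + u / c) ^ (-r) := by
  have hv : 0 < 1 + u / c := by positivity
  set v := 1 + u / c with hvdef
  have h := Measure.integral_comp_inv_smul_of_nonneg (volume : Measure (EuclideanSpace ℝ (Fin d)))
    (fun z => (1 + ‖z‖ ^ 2 / c) ^ (-(r + d / 2))) (Real.sqrt_nonneg v)
  rw [finrank_euclideanSpace_fin, smul_eq_mul] at h
  have hz (z : EuclideanSpace ℝ (Fin d)) : (1 + (u + ‖z‖ ^ 2) / c) ^ (-(r + d / 2)) =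
      v ^ (-(r + d / 2)) * (1 + ‖(√v)⁻¹ • z‖ ^ 2 / c) ^ (-(r + d / 2)) := by
    rw [norm_smul, mul_pow, norm_inv, inv_pow, Real.norm_eq_abs, sq_abs, Real.sq_sqrt hv.le,
      ← Real.mul_rpow hv.le (by positivity)]
    congr 1
    field_simp
    rw [hvdef]
    field_simp
    ring
  simp_rw [hz]
  rw [integral_const_mul, h, ← mul_assoc, mul_comm, Real.sqrt_eq_rpow, ← Real.rpow_natCast,
    ← Real.rpow_mul hv.le, ← Real.rpow_add hv]
  congr 2
  ring

/-- marginal consistency of multivariate q-Gaussians (Kolmogorov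
consistency for the generalized Wiener process): with `N = nd`, `M = (n-1)d`,
`Λ` symmetric positive-definite `N×N` with top-left `M×M` block `Λ₁₁`, for all `x ∈ ℝ^M`,
`∫_{ℝ^d} G^{(N)}_{q̂_N}((x,z);Λ) dz = G^{(M)}_{q̂_M}(x;Λ₁₁)`. -/
theorem stmt11 (d n : ℕ) (hd : 1 ≤ d) (hn : 2 ≤ n) (q : ℝ)
    (hq1 : 1 ≤ q) (hq2 : q < ((d : ℝ) + 4) / ((d : ℝ) + 2))
    (Λ : Matrix (Fin ((n - 1) * d + d)) (Fin ((n - 1) * d + d)) ℝ)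
    (hΛ : Λ.PosDef) (hΛsymm : Λ.IsSymm)
    (x : Fin ((n - 1) * d) → ℝ) :
    (∫ z : EuclideanSpace ℝ (Fin d),
        GQm (qhat q d (n * d)) ((n - 1) * d + d) Λ (Fin.append x z)) =
      GQm (qhat q d ((n - 1) * d)) ((n - 1) * d)
        (Λ.submatrix (Fin.castAdd d) (Fin.castAdd d)) x := by
  have hM : (n - 1) * d ≠ 0 := by
    have : n - 1 ≠ 0 := by omega
    positivity
  have hnd : n * d = (n - 1) * d + d := by
    obtain ⟨k, rfl⟩ : ∃ k, n = k + 1 := ⟨n - 1, by omega⟩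
    simp [Nat.succ_mul]
  rw [hnd]
  generalize (n - 1) * d = M at hM Λ x
  have hN : M + d ≠ 0 := by omega
  have hd0 : (0 : ℝ) ≤ d := d.cast_nonneg
  rcases hq1.eq_or_lt with rfl | hq1
  · have hqhat (m : ℕ) : qhat 1 d m = 1 := by simp [qhat]
    obtain ⟨hN1, hN2⟩ := integral_qExp_pos_and_twoQm_one hN
    obtain ⟨hM1, hM2⟩ := integral_qExp_pos_and_twoQm_one hM
    simp_rw [hqhat, GQm_eq hN (hN2.symm ▸ two_pos) hN1, GQm_eq hM (hM2.symm ▸ two_pos) hM1,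
      hN2, hM2, qExp_one]
    have hK : 0 < ∫ z : EuclideanSpace ℝ (Fin d), Real.exp (-(‖z‖ ^ 2 / 2)) :=
      integral_norm_sq_pos_of_integrable (f := fun u => Real.exp (-(u / 2))) (by fun_prop)
        (integrable_exp_neg_norm_sq_div two_pos) fun u _ => Real.exp_pos _
    refine integral_elliptical_marginal (φ := fun u => Real.exp (-(u / 2)))
      (ψ := fun u => Real.exp (-(u / 2))) hK.ne' (integrable_exp_neg_norm_sq_div two_pos)
      (fun u _ => ?_) hΛ x
    rw [← integral_mul_const]
    congr with z
    rw [← Real.exp_add]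
    congr 1
    ring
  · have hs : 0 < q - 1 := sub_pos.mpr hq1
    set p : ℝ := (q - 1)⁻¹ with hpdef
    have hp : (d : ℝ) / 2 + 1 < p := by
      rw [lt_div_iff₀ (by positivity)] at hq2
      rw [hpdef, inv_eq_one_div, lt_div_iff₀ hs]
      linarith
    have hp' (m : ℕ) : (m : ℝ) / 2 + 1 < p + (m - d) / 2 := by linarith
    have hpos (m : ℕ) : 0 < p + ((m : ℝ) - d) / 2 :=
      lt_trans (by positivity) (hp' m)
    have hqhat (m : ℕ) : qhat q d m = 1 + (p + ((m : ℝ) - d) / 2)⁻¹ := by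
      have h1 : 2 - ((m : ℝ) - d) * (1 - q) = 2 * (q - 1) * (p + ((m : ℝ) - d) / 2) := by
        rw [hpdef]
        field_simp
        ring
      have h2 : 2 * q - ((m : ℝ) - d) * (1 - q) =
        2 * (q - 1) + 2 * (q - 1) * (p + ((m : ℝ) - d) / 2) := by rw [← h1]; ring
      have h3 := (hpos m).ne'
      rw [qhat, h1, h2, add_div, div_self (by positivity),
        div_mul_cancel_left₀ (by positivity), add_comm]
    set c : ℝ := 2 * (p - 1) - d with hcdef
    have hc : 0 < c := by linarith
    have htwo (m : ℕ) (hm : m ≠ 0) :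
        twoQm (1 + (p + ((m : ℝ) - d) / 2)⁻¹) m = c / (p + ((m : ℝ) - d) / 2) := by
      rw [(integral_qExp_pos_and_twoQm_one_add_inv hm (hp' m)).2]
      congr 1
      ring
    have hG (m : ℕ) (hm : m ≠ 0) {S : Matrix (Fin m) (Fin m) ℝ} (hS : S.PosDef) (y : Fin m → ℝ) :
        GQm (qhat q d m) m S y =
          (1 + (y ⬝ᵥ (S⁻¹ *ᵥ y)) / c) ^ (-(p + ((m : ℝ) - d) / 2)) /
            ((∫ x : EuclideanSpace ℝ (Fin m),
              (1 + ‖x‖ ^ 2 / c) ^ (-(p + ((m : ℝ) - d) / 2))) * √S.det) := by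
      have hpm := hpos m
      have hprof (u : ℝ) (hu : 0 ≤ u) : qExp (1 + (p + ((m : ℝ) - d) / 2)⁻¹)
          (-(u / (c / (p + ((m : ℝ) - d) / 2)))) =
            (1 + u / c) ^ (-(p + ((m : ℝ) - d) / 2)) := by
        rw [qExp_one_add_inv hpm (by positivity)]
        rw [div_div, div_mul_cancel₀ _ hpm.ne']
      have hy : 0 ≤ y ⬝ᵥ (S⁻¹ *ᵥ y) := by
        simpa using hS.inv.posSemidef.dotProduct_mulVec_nonneg y
      rw [hqhat, GQm_eq hm (by rw [htwo m hm]; positivity)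
        (integral_qExp_pos_and_twoQm_one_add_inv hm (hp' m)).1, htwo m hm, hprof _ hy]
      simp_rw [hprof _ (sq_nonneg _)]
    have hexp : p + (((M + d : ℕ) : ℝ) - d) / 2 = p + ((M : ℝ) - d) / 2 + d / 2 := by
      push_cast
      ring
    simp_rw [hG _ hN hΛ, hG _ hM (hΛ.submatrix (Fin.castAdd_injective M d)), hexp]
    have hM' := hp' M
    have hK : 0 < ∫ z : EuclideanSpace ℝ (Fin d),
        (1 + ‖z‖ ^ 2 / c) ^ (-(p + ((M : ℝ) - d) / 2 + d / 2)) :=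
      integral_norm_sq_pos_of_integrable
        (f := fun u => (1 + u / c) ^ (-(p + ((M : ℝ) - d) / 2 + d / 2)))
        (Continuous.rpow_const (by fun_prop) fun z => Or.inl (by positivity))
        (integrable_one_add_norm_sq_div_rpow_neg hc (by linarith [M.cast_nonneg (α := ℝ)]))
        fun u hu => by positivity
    exact integral_elliptical_marginal
      (φ := fun u => (1 + u / c) ^ (-(p + ((M : ℝ) - d) / 2 + d / 2)))
      (ψ := fun u => (1 + u / c) ^ (-(p + ((M : ℝ) - d) / 2))) hK.ne'
      (integrable_one_add_norm_sq_div_rpow_neg hc (by push_cast; linarith))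
      (fun u hu => integral_one_add_add_norm_sq_rpow hc hu) hΛ x
end

section
/- Positive semidefiniteness of the covariance kernel of the generalized Wiener process: let h be a real number with 0 < h ≤ 2. Then for every integer n ≥ 1, all t₁, …, t_n ∈ [0,∞), and all c₁, …, c_n ∈ ℝ, one has ∑_{i,j=1}^n c_i c_j · ½ (t_i^h + t_j^h − |t_i − t_j|^h) ≥ 0; that is, the matrix with entries ½ (t_i^h + t_j^h − |t_i − t_j|^h) is positive semidefinite. -/
open Real

open MeasureTheory Set in
/-- The Lévy–Khinchin integrand of `|u| ^ h` is integrable for `0 < h < 2`. -/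
lemma integrableOn_one_sub_cos_mul_rpow {h : ℝ} (h0 : 0 < h) (h2 : h < 2) (u : ℝ) :
    IntegrableOn (fun x : ℝ => (1 - cos (u * x)) * x ^ (-1 - h)) (Ioi 0) := by
  have hmeas : Measurable (fun x : ℝ => (1 - cos (u * x)) * x ^ (-1 - h)) := by fun_prop
  rw [← Ioc_union_Ioi_eq_Ioi zero_le_one, integrableOn_union]
  constructor
  · have hi : IntegrableOn (fun x : ℝ => u ^ 2 / 2 * x ^ (1 - h)) (Ioc 0 1) := by
      refine Integrable.const_mul ?_ _
      rw [← IntegrableOn, ← intervalIntegrable_iff_integrableOn_Ioc_of_le zero_le_one]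
      exact intervalIntegral.intervalIntegrable_rpow' (by linarith)
    refine hi.mono' hmeas.aestronglyMeasurable ?_
    refine (ae_restrict_iff' measurableSet_Ioc).2 (ae_of_all _ fun x hx => ?_)
    have hx0 : 0 < x := hx.1
    have hc : 0 ≤ 1 - cos (u * x) := sub_nonneg.2 (cos_le_one _)
    have hp : x ^ (1 - h) = x ^ 2 * x ^ (-1 - h) := by
      rw [← rpow_natCast, ← rpow_add hx0]
      congr 1
      push_cast
      ring
    rw [norm_of_nonneg (mul_nonneg hc (rpow_nonneg hx0.le _)), hp, ← mul_assoc]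
    refine mul_le_mul_of_nonneg_right ?_ (rpow_nonneg hx0.le _)
    nlinarith [one_sub_sq_div_two_le_cos (x := u * x)]
  · have hi : IntegrableOn (fun x : ℝ => 2 * x ^ (-1 - h)) (Ioi 1) :=
      (integrableOn_Ioi_rpow_of_lt (by linarith) one_pos).const_mul _
    refine hi.mono' hmeas.aestronglyMeasurable ?_
    refine (ae_restrict_iff' measurableSet_Ioi).2 (ae_of_all _ fun x hx => ?_)
    have hx0 : 0 < x := one_pos.trans hx
    have hc : 0 ≤ 1 - cos (u * x) := sub_nonneg.2 (cos_le_one _)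
    rw [norm_of_nonneg (mul_nonneg hc (rpow_nonneg hx0.le _))]
    refine mul_le_mul_of_nonneg_right ?_ (rpow_nonneg hx0.le _)
    linarith [neg_one_le_cos (u * x)]

open MeasureTheory Set in
lemma integral_one_sub_cos_mul_rpow {h : ℝ} (h0 : 0 < h) (u : ℝ) :
    ∫ x in Ioi (0 : ℝ), (1 - cos (u * x)) * x ^ (-1 - h) =
      |u| ^ h * ∫ x in Ioi (0 : ℝ), (1 - cos x) * x ^ (-1 - h) := by
  rcases eq_or_ne u 0 with rfl | hu
  · simp [zero_rpow h0.ne']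
  have hu' : 0 < |u| := abs_pos.2 hu
  have hscale := integral_comp_mul_left_Ioi
    (fun x : ℝ => (1 - cos x) * x ^ (-1 - h)) 0 hu'
  rw [mul_zero, smul_eq_mul] at hscale
  have hcongr : ∫ x in Ioi (0 : ℝ), (1 - cos (u * x)) * x ^ (-1 - h) =
      ∫ x in Ioi (0 : ℝ), |u| ^ (1 + h) * ((1 - cos (|u| * x)) * (|u| * x) ^ (-1 - h)) := by
    refine setIntegral_congr_fun measurableSet_Ioi fun x hx => ?_
    have hx0 : 0 < x := hx
    have hcos : cos (u * x) = cos (|u| * x) := by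
      rw [← cos_abs (u * x), abs_mul, abs_of_pos hx0]
    have hone : |u| ^ (1 + h) * |u| ^ (-1 - h) = 1 := by
      rw [← rpow_add hu']
      ring_nf
      exact rpow_zero _
    simp only [mul_rpow hu'.le hx0.le, hcos]
    linear_combination (-(1 - cos (|u| * x)) * x ^ (-1 - h)) * hone
  rw [hcongr, integral_const_mul, hscale, rpow_add hu', rpow_one]
  field_simp

open MeasureTheory Set in
lemma integral_one_sub_cos_mul_rpow_pos {h : ℝ} (h0 : 0 < h) (h2 : h < 2) :
    0 < ∫ x in Ioi (0 : ℝ), (1 - cos x) * x ^ (-1 - h) := by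
  have hint := integrableOn_one_sub_cos_mul_rpow h0 h2 1
  simp only [one_mul] at hint
  rw [setIntegral_pos_iff_support_of_nonneg_ae _ hint]
  · refine lt_of_lt_of_le ?_ (measure_mono (s := Ioo 0 1) fun x hx => ⟨?_, hx.1⟩)
    · simp
    · have hx1 : cos x < 1 := by
        rw [← cos_zero]
        exact cos_lt_cos_of_nonneg_of_le_pi_div_two le_rfl
          (by linarith [hx.2, pi_gt_three]) hx.1
      exact (mul_pos (sub_pos.2 hx1) (rpow_pos_of_pos hx.1 _)).ne'
  · refine (ae_restrict_iff' measurableSet_Ioi).2 (ae_of_all _ fun x hx => ?_)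
    exact mul_nonneg (sub_nonneg.2 (cos_le_one x)) (rpow_nonneg (le_of_lt hx) _)

lemma sum_mul_one_sub_cos_nonneg {ι : Type*} (s : Finset ι) (t c : ι → ℝ) :
    0 ≤ ∑ i ∈ s, ∑ j ∈ s,
      c i * c j * ((1 - cos (t i)) + (1 - cos (t j)) - (1 - cos (t i - t j))) := by
  have heq : ∑ i ∈ s, ∑ j ∈ s,
      c i * c j * ((1 - cos (t i)) + (1 - cos (t j)) - (1 - cos (t i - t j))) =
      (∑ i ∈ s, c i * (1 - cos (t i))) ^ 2 + (∑ i ∈ s, c i * sin (t i)) ^ 2 := by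
    rw [sq, sq, Finset.sum_mul_sum, Finset.sum_mul_sum, ← Finset.sum_add_distrib]
    refine Finset.sum_congr rfl fun i _ => ?_
    rw [← Finset.sum_add_distrib]
    refine Finset.sum_congr rfl fun j _ => ?_
    rw [cos_sub]
    ring
  rw [heq]
  positivity

open MeasureTheory Set in
lemma sum_mul_abs_rpow_nonneg {ι : Type*} (s : Finset ι) {h : ℝ} (h0 : 0 < h) (h2 : h < 2)
    (t c : ι → ℝ) :
    0 ≤ ∑ i ∈ s, ∑ j ∈ s, c i * c j * (|t i| ^ h + |t j| ^ h - |t i - t j| ^ h) := by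
  have hint := integrableOn_one_sub_cos_mul_rpow h0 h2
  have hK := integral_one_sub_cos_mul_rpow_pos h0 h2
  refine nonneg_of_mul_nonneg_left ?_ hK
  have heq : (∑ i ∈ s, ∑ j ∈ s, c i * c j * (|t i| ^ h + |t j| ^ h - |t i - t j| ^ h)) *
      ∫ x in Ioi (0 : ℝ), (1 - cos x) * x ^ (-1 - h) =
      ∫ x in Ioi (0 : ℝ), ∑ i ∈ s, ∑ j ∈ s, c i * c j *
        ((1 - cos (t i * x)) * x ^ (-1 - h) + (1 - cos (t j * x)) * x ^ (-1 - h) -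
          (1 - cos ((t i - t j) * x)) * x ^ (-1 - h)) := by
    have hij : ∀ i j, Integrable (fun x : ℝ => c i * c j *
        ((1 - cos (t i * x)) * x ^ (-1 - h) + (1 - cos (t j * x)) * x ^ (-1 - h) -
          (1 - cos ((t i - t j) * x)) * x ^ (-1 - h))) (volume.restrict (Ioi 0)) := fun i j =>
      (((hint (t i)).add (hint (t j))).sub (hint (t i - t j))).const_mul _
    rw [integral_finsetSum _ fun i _ => integrable_finsetSum _ fun j _ => hij i j, Finset.sum_mul]
    refine Finset.sum_congr rfl fun i _ => ?_
    rw [integral_finsetSum _ fun j _ => hij i j, Finset.sum_mul]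
    refine Finset.sum_congr rfl fun j _ => ?_
    rw [integral_const_mul,
      integral_sub (Integrable.fun_add (hint (t i)) (hint (t j))) (hint (t i - t j)),
      integral_add (hint (t i)) (hint (t j))]
    simp only [integral_one_sub_cos_mul_rpow h0]
    ring
  rw [heq]
  refine setIntegral_nonneg measurableSet_Ioi fun x hx => ?_
  have hx0 : 0 < x := hx
  refine (mul_nonneg (sum_mul_one_sub_cos_nonneg s (fun i => t i * x) c)
    (rpow_nonneg hx0.le (-1 - h))).trans_eq ?_
  simp only [Finset.sum_mul, sub_mul (t _) (t _) x]
  refine Finset.sum_congr rfl fun i _ => Finset.sum_congr rfl fun j _ => ?_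
  ring

/-- positive semidefiniteness of the fractional-Brownian-motion-type
covariance kernel `½(t^h + s^h - |t-s|^h)` of the generalized Wiener process, for
`0 < h ≤ 2`: every quadratic form built from it on nonnegative times is nonnegative. -/
theorem stmt12 (h : ℝ) (h0 : 0 < h) (h2 : h ≤ 2) (n : ℕ) (hn : 1 ≤ n)
    (t : Fin n → ℝ) (ht : ∀ i, 0 ≤ t i) (c : Fin n → ℝ) :
    0 ≤ ∑ i : Fin n, ∑ j : Fin n,
      c i * c j * (1 / 2 * (t i ^ h + t j ^ h - |t i - t j| ^ h)) := by
  rcases h2.lt_or_eq with h2 | rfl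
  · refine (mul_nonneg one_half_pos.le
      (sum_mul_abs_rpow_nonneg Finset.univ h0 h2 t c)).trans_eq ?_
    simp only [Finset.mul_sum, abs_of_nonneg (ht _)]
    refine Finset.sum_congr rfl fun i _ => Finset.sum_congr rfl fun j _ => ?_
    ring
  · refine (sq_nonneg (∑ i, c i * t i)).trans_eq ?_
    rw [sq, Finset.sum_mul_sum]
    refine Finset.sum_congr rfl fun i _ => Finset.sum_congr rfl fun j _ => ?_
    simp only [rpow_two, sq_abs]
    ring
end
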